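/- arXiv:1308.4437 — 2 statements merged into one kernel-verified Lean document; each statement's English description precedes it below -/
import Mathlib

section
/- Let k ≥ 3 be an integer. The set {DF(β) : β ∈ [k−1, k]} (with DF(k−1) = F and DF(k) = Δ), regarded as a subspace of the space of nonempty compact subsets of Δ with the Hausdorff metric, is homeomorphic to a compact interval. -/
open Filter Topology
open scoped Classical

namespace BetaDF

/-- Digit sequences (elements of `Σ = {0,…,k−1}^ℕ` when all entries are `< k`). -/
abbrev Seq : Type := ℕ → ℕ

/-- Lexicographic (strict) order on digit sequences. -/
def seqLt (v w : Seq) : Prop := ∃ r, (∀ s, s < r → v s = w s) ∧ v r < w r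

/-- Lexicographic order on digit sequences. -/
def seqLe (v w : Seq) : Prop := seqLt v w ∨ v = w

/-- The shift map `σ`. -/
def shift (w : Seq) : Seq := fun r => w (r + 1)

/-- Membership in `Σ = {0,…,k−1}^ℕ`. -/
def InSigma (k : ℕ) (w : Seq) : Prop := ∀ r, w r < k

/-- A sequence is maximal if it is `≥` every element of its shift orbit. -/
def IsMaximal (w : Seq) : Prop := ∀ r, seqLe (shift^[r] w) w

/-- Number of occurrences of the digit `i` among the first `r` entries of `w`. -/
def digitCount (w : Seq) (i r : ℕ) : ℕ := ((Finset.range r).filter fun s => w s = i).card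

/-- The ambient Euclidean space `ℝ^k`. -/
abbrev E (k : ℕ) : Type := EuclideanSpace ℝ (Fin k)

/-- The `i`-th coordinate (with junk value `0` for `i ≥ k`). -/
def proj {k : ℕ} (α : E k) (i : ℕ) : ℝ := if h : i < k then α ⟨i, h⟩ else 0

/-- `w` has digit frequency vector `α`. -/
def HasDigitFreq (k : ℕ) (w : Seq) (α : E k) : Prop :=
  ∀ i, i < k →
    Tendsto (fun r => (digitCount w i r : ℝ) / (r : ℝ)) atTop (𝓝 (proj α i))

/-- The standard `(k−1)`-simplex `Δ`. -/
def simplex (k : ℕ) : Set (E k) := {α | (∀ i : Fin k, 0 ≤ α i) ∧ ∑ i, α i = 1}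

/-- The face `F = {α ∈ Δ : α_{k−1} = 0}`. -/
def faceF (k : ℕ) : Set (E k) := {α ∈ simplex k | proj α (k - 1) = 0}

/-- `Δ' = Δ ∖ F`. -/
def simplex' (k : ℕ) : Set (E k) := simplex k \ faceF k

/-- `J(α) = ⌊α₀/α_{k−1}⌋`. -/
noncomputable def Jfun {k : ℕ} (α : E k) : ℕ := ⌊proj α 0 / proj α (k - 1)⌋₊

/-- The map `K_n`. -/
noncomputable def Kmap {k : ℕ} (n : ℕ) (α : E k) : E k :=
  (WithLp.equiv 2 (Fin k → ℝ)).symm fun i =>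
    if (i : ℕ) + 2 < k then proj α ((i : ℕ) + 1) / (1 - proj α 0)
    else if (i : ℕ) + 2 = k then (proj α 0 - n * proj α (k - 1)) / (1 - proj α 0)
    else ((n + 1) * proj α (k - 1) - proj α 0) / (1 - proj α 0)

/-- The continued-fraction map `K : Δ' → Δ'`, `K(α) = K_{J(α)}(α)`. -/
noncomputable def Kstep {k : ℕ} (α : E k) : E k := Kmap (Jfun α) α

/-- The itinerary map `Φ(α)_r = J(K^r(α))`. -/
noncomputable def Phi {k : ℕ} (α : E k) : ℕ → ℕ := fun r => Jfun (Kstep^[r] α)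

/-- The projective embedding `K_n^{-1} : Δ → Δ`. -/
noncomputable def Kinv {k : ℕ} (n : ℕ) (α : E k) : E k :=
  (WithLp.equiv 2 (Fin k → ℝ)).symm fun i =>
    (if (i : ℕ) = 0 then (n + 1) * proj α (k - 2) + n * proj α (k - 1)
      else if (i : ℕ) + 1 = k then proj α (k - 2) + proj α (k - 1)
      else proj α ((i : ℕ) - 1)) /
      ((n + 1) * proj α (k - 2) + n * proj α (k - 1) + 1)

/-- `Υ_{n,r} = K_{n₀}^{-1} ∘ ⋯ ∘ K_{n_r}^{-1}`. -/
noncomputable def Ups {k : ℕ} (n : ℕ → ℕ) : ℕ → E k → E k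
  | 0 => Kinv (n 0)
  | r + 1 => fun α => Ups n r (Kinv (n (r + 1)) α)

/-- `A_{n,r} = Υ_{n,r}(Δ)`. -/
noncomputable def Anr (k : ℕ) (n : ℕ → ℕ) (r : ℕ) : Set (E k) := Ups n r '' simplex k

/-- `F_{n,r} = Υ_{n,r}(F)`. -/
noncomputable def Fnr (k : ℕ) (n : ℕ → ℕ) (r : ℕ) : Set (E k) := Ups n r '' faceF k

/-- Reverse-lexicographic strict order on `ℕ^ℕ`: `a < b` iff `a` exceeds `b`
at the first index where they differ. -/
def revLexLt (a b : ℕ → ℕ) : Prop := ∃ r, (∀ s, s < r → a s = b s) ∧ b r < a r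

/-- The word to which the substitution `Λ_n` sends the digit `i`. -/
def lamWord (k n i : ℕ) : List ℕ :=
  if i + 2 < k then [i + 1]
  else if i + 2 = k then (k - 1) :: List.replicate (n + 1) 0
  else (k - 1) :: List.replicate n 0

/-- The substitution `Λ_n : Σ → Σ`. -/
def lamSub (k n : ℕ) (w : Seq) : Seq := fun m =>
  (((List.range (m + 1)).map fun r => lamWord k n (w r)).flatten).getD m 0

/-- `Λ_{n,r} = Λ_{n₀} ∘ ⋯ ∘ Λ_{n_r}`. -/
def lamChain (k : ℕ) (n : ℕ → ℕ) : ℕ → Seq → Seq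
  | 0 => lamSub k (n 0)
  | r + 1 => fun w => lamChain k n r (lamSub k (n (r + 1)) w)

/-- `Λ_{n₀} ∘ ⋯ ∘ Λ_{n_{R−1}}` for a finite list of indices. -/
def lamList (k : ℕ) : List ℕ → Seq → Seq
  | [], w => w
  | a :: t, w => lamSub k a (lamList k t w)

/-- The constant sequence `(k−1)(k−1)(k−1)…`. -/
def topSeq (k : ℕ) : Seq := fun _ => k - 1

/-- The sequence `(k−1)000…`. -/
def baseSeq (k : ℕ) : Seq := fun m => if m = 0 then k - 1 else 0

/-- `S(n) = lim_{r→∞} Λ_{n,r}((k−1)(k−1)(k−1)…)` (limit in the product topology). -/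
noncomputable def Sseq (k : ℕ) (n : ℕ → ℕ) : Seq :=
  limUnder atTop fun r => lamChain k n r (topSeq k)

/-- The compactified itinerary space `N`: sequences with values in `ℕ∞` such that
all entries from the first `∞` onwards equal `∞`.  Elements with no `∞` entry
correspond to `ℕ^ℕ`; the others are the finite type elements `n₀…n_{R−1}∞`. -/
def NN : Type := {m : ℕ → ℕ∞ // ∀ r, m r = ⊤ → m (r + 1) = ⊤}

/-- Reverse-lexicographic strict order on `N` (`∞` counts as larger than every natural). -/
def nnLt (m n : NN) : Prop := ∃ r, (∀ s, s < r → m.1 s = n.1 s) ∧ n.1 r < m.1 r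

/-- Reverse-lexicographic order on `N`. -/
def nnLe (m n : NN) : Prop := nnLt m n ∨ m = n

/-- The element of `N` determined by an element of `ℕ^ℕ`. -/
def toNN (g : ℕ → ℕ) : NN := ⟨fun r => (g r : ℕ∞), fun r h => absurd h (by simp)⟩

/-- The itinerary `n₀ … n_{R−1} (n_R + 1) 0 0 0 …` (of rational type). -/
def ratSeq (f : ℕ → ℕ) (R : ℕ) : ℕ → ℕ := fun r =>
  if r < R then f r else if r = R then f R + 1 else 0

/-- The finite type element `n₀ … n_{R−1} n_R ∞` of `N`. -/
def finNN (f : ℕ → ℕ) (R : ℕ) : NN :=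
  ⟨fun r => if r ≤ R then (f r : ℕ∞) else ⊤, by
    intro r h
    show (if r + 1 ≤ R then ((f (r + 1) : ℕ∞)) else ⊤) = ⊤
    have h' : (if r ≤ R then ((f r : ℕ∞)) else ⊤) = ⊤ := h
    by_cases h1 : r ≤ R
    · rw [if_pos h1] at h'
      exact absurd h' (by simp)
    · rw [if_neg (by omega : ¬ r + 1 ≤ R)]⟩

/-- The extension of `S` to `N`. -/
noncomputable def SN (k : ℕ) (m : NN) : Seq :=
  if h : ∃ R, m.1 R = ⊤ then
    lamList k ((List.range (Nat.find h)).map fun r => (m.1 r).toNat) (baseSeq k)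
  else Sseq k fun r => (m.1 r).toNat

/-- The metric `d(m,n) = 2^{−X(m,n)}` on `N`, where
`X(m,n) = r + min(m₀+⋯+m_r, n₀+⋯+n_r)` and `r` is the first index where `m,n` differ. -/
noncomputable def dN (m n : NN) : ℝ :=
  if h : m = n then 0
  else
    have hex : ∃ r, m.1 r ≠ n.1 r := by
      by_contra hc
      push_neg at hc
      exact h (Subtype.ext (funext hc))
    (2 : ℝ) ^ (-(((Nat.find hex : ℕ) : ℤ) +
      ((min (∑ s ∈ Finset.range (Nat.find hex + 1), m.1 s)
            (∑ s ∈ Finset.range (Nat.find hex + 1), n.1 s)).toNat : ℤ)))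

/-- The symbolic β-shift `X(w)`. -/
def Xset (k : ℕ) (w : Seq) : Set Seq :=
  {v | InSigma k v ∧ ∀ r, seqLe (shift^[r] v) w}

/-- The digit frequency set `DF(w)` of the symbolic β-shift `X(w)`. -/
def DFw (k : ℕ) (w : Seq) : Set (E k) :=
  {α | α ∈ simplex k ∧ ∃ v ∈ Xset k w, HasDigitFreq k v α}

/-- `DF(n) = DF(S(n))` for `n ∈ ℕ^ℕ`. -/
noncomputable def DFn (k : ℕ) (n : ℕ → ℕ) : Set (E k) := DFw k (Sseq k n)

/-- `DF(n) = DF(S(n))` for `n ∈ N`. -/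
noncomputable def DFN (k : ℕ) (m : NN) : Set (E k) := DFw k (SN k m)

/-- The infimax map `I = S ∘ Φ` on `Δ'`, extended by `I(α) = (k−1)000…` on `F`. -/
noncomputable def Ifun (k : ℕ) (α : E k) : Seq :=
  if α ∈ simplex' k then Sseq k (Phi α) else baseSeq k

/-- The simplex `T_m = {α ∈ Δ : (m+1)α_{k−1} ≤ α₀}`. -/
def Tset (k m : ℕ) : Set (E k) :=
  {α ∈ simplex k | ((m : ℝ) + 1) * proj α (k - 1) ≤ proj α 0}

/-- The standard basis vector `e_i`. -/
noncomputable def evec (k i : ℕ) : E k :=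
  (WithLp.equiv 2 (Fin k → ℝ)).symm fun j => if (j : ℕ) = i then 1 else 0

/-- The rational extreme points
`FE(n) = {Υ_{n,s}(e_{k−2}) : n_{s+t} ≠ 0 for some 1 ≤ t ≤ k−2}`. -/
noncomputable def FEset (k : ℕ) (n : ℕ → ℕ) : Set (E k) :=
  {α | ∃ s, (∃ t, 1 ≤ t ∧ t ≤ k - 2 ∧ n (s + t) ≠ 0) ∧ α = Ups n s (evec k (k - 2))}

/-- The set `E(n)` of non-trivial extreme points of `DF(n)`:
extreme points other than `e₀,…,e_{k−2}`. -/
noncomputable def Eset (k : ℕ) (n : ℕ → ℕ) : Set (E k) :=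
  Set.extremePoints ℝ (DFn k n) \ {α | ∃ i, i ≤ k - 2 ∧ α = evec k i}

/-- The fiber `Φ^{-1}(n) ⊆ Δ'`. -/
noncomputable def PhiFiber (k : ℕ) (n : ℕ → ℕ) : Set (E k) :=
  {α ∈ simplex' k | Phi α = n}

/-- `f_β(x) = βx mod 1`. -/
noncomputable def fbeta (β x : ℝ) : ℝ := Int.fract (β * x)

/-- The digit sequence of the greedy β-expansion of `x`: `d_β(x)_r = ⌊β f_β^r(x)⌋`. -/
noncomputable def dbeta (β : ℝ) (x : ℝ) : Seq := fun r => ⌊β * (fbeta β)^[r] x⌋₊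

/-- The digit frequency set `DF(β)` of β-expansions of points of `[0,1]`. -/
noncomputable def DFbeta (k : ℕ) (β : ℝ) : Set (E k) :=
  {α | α ∈ simplex k ∧ ∃ x ∈ Set.Icc (0 : ℝ) 1, HasDigitFreq k (dbeta β x) α}

/-- The sequence `w_β`: if `d_β(1) = d₁…d_{r−1}d_r000…` with `d_r > 0` then `w_β`
is the infinite repetition of `d₁…d_{r−1}(d_r − 1)`; otherwise `w_β = d_β(1)`. -/
noncomputable def wbeta (β : ℝ) : Seq :=
  if h : ∃ r, dbeta β 1 r ≠ 0 ∧ ∀ s, r < s → dbeta β 1 s = 0 then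
    fun m =>
      if m % (Nat.find h + 1) = Nat.find h then dbeta β 1 (Nat.find h) - 1
      else dbeta β 1 (m % (Nat.find h + 1))
  else dbeta β 1

/-- `DF` extended to `[k−1,k]` by `DF(k−1) = F` and `DF(k) = Δ`. -/
noncomputable def DFext (k : ℕ) (β : ℝ) : Set (E k) :=
  if β ≤ (k : ℝ) - 1 then faceF k
  else if (k : ℝ) ≤ β then simplex k
  else DFbeta k β

/-- The mode-locking interval `I_{n₀…n_R}` determined by the word `f 0, …, f R`. -/
noncomputable def Iint (k : ℕ) (f : ℕ → ℕ) (R : ℕ) : Set ℝ :=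
  {β | (k : ℝ) - 1 < β ∧ β < k ∧
    seqLe (Sseq k (ratSeq f R)) (wbeta β) ∧ seqLe (wbeta β) (SN k (finNN f R))}

/-- The frequency vector of the first `s` digits of `w`. -/
noncomputable def freqVec (k : ℕ) (w : Seq) (s : ℕ) : E k :=
  (WithLp.equiv 2 (Fin k → ℝ)).symm fun i => (digitCount w (i : ℕ) s : ℝ) / (s : ℝ)


/-- The collection `{DF(β) : β ∈ [k−1,k]}`, as a subspace of the nonempty compact subsets
of `Δ` with the Hausdorff metric. -/
noncomputable def Dfull (k : ℕ) : Set (TopologicalSpace.NonemptyCompacts (E k)) :=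
  {C | ∃ β ∈ Set.Icc ((k : ℝ) - 1) (k : ℝ), (C : Set (E k)) = DFext k β}


/-! ### Values of digit sequences in base `β` -/

/-- The value of the tail of `v` starting at `r` in base `β`. -/
noncomputable def tv (β : ℝ) (v : Seq) (r : ℕ) : ℝ := ∑' j, (v (r + j) : ℝ) * β⁻¹ ^ (j + 1)

/-- Sequences all of whose tails have value less than one. -/
def Adm (k : ℕ) (β : ℝ) : Set Seq := {v | (∀ r, v r < k) ∧ ∀ r, tv β v r < 1}

lemma inv_bd {β : ℝ} (hβ : 2 ≤ β) : 0 < β⁻¹ ∧ β⁻¹ ≤ 1 / 2 := by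
  refine ⟨by positivity, ?_⟩
  rw [one_div]
  exact inv_anti₀ (by norm_num) hβ

lemma geo_summ {β : ℝ} (hβ : 2 ≤ β) : Summable (fun j : ℕ => β⁻¹ ^ (j + 1)) := by
  have h := inv_bd hβ
  exact (summable_nat_add_iff 1).2 (summable_geometric_of_lt_one h.1.le (by linarith))

lemma geo_sum {β : ℝ} (hβ : 2 ≤ β) : ∑' j : ℕ, β⁻¹ ^ (j + 1) = 1 / (β - 1) := by
  have h := inv_bd hβ
  simp_rw [pow_succ]
  rw [tsum_mul_right, tsum_geometric_of_lt_one h.1.le (by linarith)]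
  have : β - 1 ≠ 0 := by linarith
  have h0 : β ≠ 0 := by linarith
  have : 1 - β⁻¹ ≠ 0 := by linarith
  field_simp

lemma tv_summ {k : ℕ} {β : ℝ} (hβ : 2 ≤ β) {v : Seq} (hv : ∀ r, v r < k) (r : ℕ) :
    Summable (fun j : ℕ => (v (r + j) : ℝ) * β⁻¹ ^ (j + 1)) := by
  have h := inv_bd hβ
  refine Summable.of_nonneg_of_le (fun j => by positivity) (fun j => ?_)
    ((geo_summ hβ).mul_left (k : ℝ))
  have : (v (r + j) : ℝ) ≤ k := by exact_mod_cast (hv _).le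
  gcongr

lemma tv_nonneg {β : ℝ} (hβ : 2 ≤ β) (v : Seq) (r : ℕ) : 0 ≤ tv β v r := by
  have h := inv_bd hβ
  exact tsum_nonneg fun j => by positivity

lemma tv_split {k : ℕ} {β : ℝ} (hβ : 2 ≤ β) {v : Seq} (hv : ∀ r, v r < k) (r n : ℕ) :
    tv β v r = ∑ j ∈ Finset.range n, (v (r + j) : ℝ) * β⁻¹ ^ (j + 1)
      + β⁻¹ ^ n * tv β v (r + n) := by
  unfold tv
  rw [← (tv_summ hβ hv r).sum_add_tsum_nat_add n, ← tsum_mul_left]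
  congr 1
  refine tsum_congr fun j => ?_
  rw [show r + (j + n) = r + n + j by ring, show j + n + 1 = n + (j + 1) by ring, pow_add]
  ring

lemma tv_step {k : ℕ} {β : ℝ} (hβ : 2 ≤ β) {v : Seq} (hv : ∀ r, v r < k) (r : ℕ) :
    β * tv β v r = v r + tv β v (r + 1) := by
  rw [tv_split hβ hv r 1]
  have h0 : β ≠ 0 := by linarith
  simp
  field_simp

lemma tv_mono {k : ℕ} {β : ℝ} (hβ : 2 ≤ β) {v w : Seq} (hv : ∀ r, v r < k) (hwv : ∀ s, w s ≤ v s)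
    (r : ℕ) : tv β w r ≤ tv β v r := by
  have h := inv_bd hβ
  refine Summable.tsum_le_tsum (fun j => ?_) (tv_summ hβ (fun s => (hwv s).trans_lt (hv s)) r)
    (tv_summ hβ hv r)
  have : (w (r + j) : ℝ) ≤ v (r + j) := by exact_mod_cast hwv _
  gcongr

lemma tv_le_k {k : ℕ} {β : ℝ} (hβ : 2 ≤ β) {v : Seq} (hv : ∀ r, v r < k) (r : ℕ) :
    tv β v r ≤ k := by
  have h := inv_bd hβ
  calc tv β v r ≤ ∑' j : ℕ, (k : ℝ) * β⁻¹ ^ (j + 1) := by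
        refine Summable.tsum_le_tsum (fun j => ?_) (tv_summ hβ hv r) ((geo_summ hβ).mul_left _)
        have : (v (r + j) : ℝ) ≤ k := by exact_mod_cast (hv _).le
        gcongr
    _ = k * (1 / (β - 1)) := by rw [tsum_mul_left, geo_sum hβ]
    _ ≤ k * 1 := by
        gcongr
        rw [div_le_one (by linarith)]
        linarith
    _ = k := mul_one _

lemma sum_lower {β : ℝ} (hβ : 2 ≤ β) {v w : Seq} (r r' n : ℕ)
    (hwv : ∀ j < n, w (r + j) ≤ v (r' + j)) (j : ℕ) (hj : j < n)
    (hlt : w (r + j) + 1 ≤ v (r' + j)) :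
    ∑ j ∈ Finset.range n, (w (r + j) : ℝ) * β⁻¹ ^ (j + 1) + β⁻¹ ^ n ≤
      ∑ j ∈ Finset.range n, (v (r' + j) : ℝ) * β⁻¹ ^ (j + 1) := by
  have h := inv_bd hβ
  have h1 : β⁻¹ ^ n ≤ β⁻¹ ^ (j + 1) :=
    pow_le_pow_of_le_one h.1.le (by linarith) hj
  have hm : j ∈ Finset.range n := Finset.mem_range.2 hj
  rw [← Finset.add_sum_erase _ _ hm, ← Finset.add_sum_erase _ _ hm]
  have h2 : ∑ x ∈ (Finset.range n).erase j, (w (r + x) : ℝ) * β⁻¹ ^ (x + 1) ≤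
      ∑ x ∈ (Finset.range n).erase j, (v (r' + x) : ℝ) * β⁻¹ ^ (x + 1) := by
    refine Finset.sum_le_sum fun x hx => ?_
    have : (w (r + x) : ℝ) ≤ v (r' + x) := by
      exact_mod_cast hwv x (Finset.mem_range.1 (Finset.mem_of_mem_erase hx))
    gcongr
  have h3 : (w (r + j) : ℝ) + 1 ≤ v (r' + j) := by exact_mod_cast hlt
  have h4 : ((w (r + j) : ℝ) + 1) * β⁻¹ ^ (j + 1) ≤ v (r' + j) * β⁻¹ ^ (j + 1) := by gcongr
  linarith

lemma sum_le_tv {k : ℕ} {β : ℝ} (hβ : 2 ≤ β) {v : Seq} (hv : ∀ r, v r < k) (r n : ℕ) :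
    ∑ j ∈ Finset.range n, (v (r + j) : ℝ) * β⁻¹ ^ (j + 1) ≤ tv β v r := by
  have h := inv_bd hβ
  rw [tv_split hβ hv r n]
  have := tv_nonneg hβ v (r + n)
  have : 0 ≤ β⁻¹ ^ n * tv β v (r + n) := by positivity
  linarith

lemma tv_anti {k : ℕ} {β β' : ℝ} (hβ : 2 ≤ β) (hb : β ≤ β') {v : Seq} (hv : ∀ r, v r < k)
    (r : ℕ) : tv β' v r ≤ tv β v r := by
  refine Summable.tsum_le_tsum (fun j => ?_) (tv_summ (hβ.trans hb) hv r) (tv_summ hβ hv r)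
  have h' := inv_bd (hβ.trans hb)
  have : β'⁻¹ ≤ β⁻¹ := inv_anti₀ (by linarith) hb
  gcongr
  exact h'.1.le

lemma tv_change {k : ℕ} {β β' : ℝ} (hβ : 2 ≤ β) (hb : β ≤ β') {v : Seq} (hv : ∀ r, v r < k)
    (r : ℕ) : tv β v r ≤ tv β' v r + k * (β' - β) := by
  have h' := inv_bd (hβ.trans hb)
  have hi : β'⁻¹ ≤ β⁻¹ := inv_anti₀ (by linarith) hb
  have s1 := tv_summ hβ hv r
  have s2 := tv_summ (hβ.trans hb) hv r
  have g1 := geo_summ hβ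
  have g2 := geo_summ (hβ.trans hb)
  have key : tv β v r ≤ tv β' v r + ∑' j : ℕ, (k : ℝ) * (β⁻¹ ^ (j + 1) - β'⁻¹ ^ (j + 1)) := by
    unfold tv
    rw [← s2.tsum_add ((g1.sub g2).mul_left _)]
    refine Summable.tsum_le_tsum (fun j => ?_) s1 (s2.add ((g1.sub g2).mul_left _))
    have hvk : (v (r + j) : ℝ) ≤ k := by exact_mod_cast (hv _).le
    have : β'⁻¹ ^ (j + 1) ≤ β⁻¹ ^ (j + 1) := pow_le_pow_left₀ h'.1.le hi _
    nlinarith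
  rw [tsum_mul_left, g1.tsum_sub g2, geo_sum hβ, geo_sum (hβ.trans hb)] at key
  refine key.trans ?_
  have a1 : 0 < β - 1 := by linarith
  have a2 : 0 < β' - 1 := by linarith
  have : 1 / (β - 1) - 1 / (β' - 1) ≤ β' - β := by
    rw [div_sub_div _ _ a1.ne' a2.ne', div_le_iff₀ (by positivity)]
    nlinarith [mul_le_mul (show (1:ℝ) ≤ β - 1 by linarith) (show (1:ℝ) ≤ β' - 1 by linarith)
      zero_le_one a1.le]
  gcongr

/-! ### Blocks and lowering -/

/-- `b s` is the index of the block containing `s`; block `j` is `[st j, st (j+1))`. -/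
structure Blk (b st : ℕ → ℕ) : Prop where
  st0 : st 0 = 0
  lt : ∀ j, st j < st (j + 1)
  le : ∀ s, st (b s) ≤ s
  lts : ∀ s, s < st (b s + 1)

lemma Blk.mono {b st : ℕ → ℕ} (h : Blk b st) : StrictMono st := strictMono_nat_of_lt_succ h.lt

lemma Blk.uniq {b st : ℕ → ℕ} (h : Blk b st) {s j : ℕ} (h1 : st j ≤ s) (h2 : s < st (j + 1)) :
    b s = j := by
  have a1 := h.mono.lt_iff_lt.1 (h1.trans_lt (h.lts s))
  have a2 := h.mono.lt_iff_lt.1 ((h.le s).trans_lt h2)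
  omega

lemma Blk.same {b st : ℕ → ℕ} (h : Blk b st) {s t : ℕ} (h1 : s ≤ t) (h2 : t < st (b s + 1)) :
    b t = b s := h.uniq ((h.le s).trans h1) h2

lemma Blk.bmono {b st : ℕ → ℕ} (h : Blk b st) {s t : ℕ} (h1 : s ≤ t) : b s ≤ b t := by
  have a1 := h.mono.lt_iff_lt.1 ((h.le s).trans_lt (h1.trans_lt (h.lts t)))
  omega

lemma blk_div (N : ℕ) (hN : 0 < N) : Blk (fun s => s / N) (fun j => j * N) where
  st0 := by simp
  lt j := by nlinarith
  le s := Nat.div_mul_le_self s N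
  lts s := by
    have := Nat.lt_div_mul_add (a := s) hN
    show s < (s / N + 1) * N
    nlinarith

lemma blk_sqrt : Blk Nat.sqrt (fun j => j * j) where
  st0 := by simp
  lt j := by nlinarith
  le s := Nat.sqrt_le s
  lts s := Nat.lt_succ_sqrt s

/-- In each block, lower by one the last nonzero digit (if there is one). -/
noncomputable def low (b st : ℕ → ℕ) (w : Seq) : Seq := fun s =>
  if ∀ t, s < t → t < st (b s + 1) → w t = 0 then w s - 1 else w s

lemma low_le (b st : ℕ → ℕ) (w : Seq) (s : ℕ) : low b st w s ≤ w s := by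
  unfold low
  split_ifs
  · exact Nat.sub_le _ _
  · exact le_rfl

lemma low_exists {b st : ℕ → ℕ} (h : Blk b st) (w : Seq) (s : ℕ) (hs : w s ≠ 0) :
    ∃ t, s ≤ t ∧ t < st (b s + 1) ∧ low b st w t + 1 ≤ w t := by
  let P : ℕ → Prop := fun t => s ≤ t ∧ t < st (b s + 1) ∧ w t ≠ 0
  have hP : P s := ⟨le_rfl, h.lts s, hs⟩
  have hg : P (Nat.findGreatest P (st (b s + 1))) :=
    Nat.findGreatest_spec (h.lts s).le hP
  set t := Nat.findGreatest P (st (b s + 1)) with ht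
  refine ⟨t, hg.1, hg.2.1, ?_⟩
  have : low b st w t = w t - 1 := by
    unfold low
    rw [if_pos]
    intro t' h1 h2
    rw [h.same hg.1 hg.2.1] at h2
    by_contra h3
    exact Nat.findGreatest_is_greatest (P := P) (by rw [← ht]; exact h1) h2.le
      ⟨hg.1.trans h1.le, h2, h3⟩
  have := hg.2.2
  omega

/-- Concatenation of initial words of the sequences `u j`. -/
def cat (b st : ℕ → ℕ) (u : ℕ → Seq) : Seq := fun s => u (b s) (s - st (b s))

lemma cat_adm {k : ℕ} {β : ℝ} (hβ : 2 ≤ β) {b st : ℕ → ℕ} (h : Blk b st) (u : ℕ → Seq)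
    (hu : ∀ j, u j ∈ Adm k β) : low b st (cat b st u) ∈ Adm k β := by
  set w := cat b st u with hw
  set L := low b st w with hL
  have hq := inv_bd hβ
  have hLk : ∀ r, L r < k := fun r => (low_le b st w r).trans_lt ((hu _).1 _)
  -- the basic estimate
  have key : ∀ r, ∃ n, 0 < n ∧
      ∑ j ∈ Finset.range n, (L (r + j) : ℝ) * β⁻¹ ^ (j + 1) + β⁻¹ ^ n < 1 := by
    intro r
    refine ⟨st (b r + 1) - r, by have := h.lts r; omega, ?_⟩
    set n := st (b r + 1) - r with hn
    have hn0 : 0 < n := by have := h.lts r; omega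
    have hwu : ∀ j < n, w (r + j) = u (b r) ((r - st (b r)) + j) := by
      intro j hj
      have : b (r + j) = b r := h.same (by omega) (by omega)
      have h2 := h.le r
      simp only [hw, cat, this]
      congr 1
      omega
    by_cases hz : ∃ j, j < n ∧ w (r + j) ≠ 0
    · obtain ⟨j, hj, hne⟩ := hz
      obtain ⟨t, ht1, ht2, ht3⟩ := low_exists h w (r + j) hne
      rw [h.same (s := r) (t := r + j) (by omega) (by omega)] at ht2
      have hl := sum_lower hβ (v := u (b r)) (w := L) r (r - st (b r)) n
        (fun i hi => by rw [← hwu i hi]; exact low_le _ _ _ _) (t - r) (by omega)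
        (by
          rw [← hwu (t - r) (by omega), show r + (t - r) = t by omega]
          exact ht3)
      exact hl.trans_lt ((sum_le_tv hβ (hu _).1 _ _).trans_lt ((hu _).2 _))
    · push Not at hz
      have : ∑ j ∈ Finset.range n, (L (r + j) : ℝ) * β⁻¹ ^ (j + 1) = 0 := by
        refine Finset.sum_eq_zero fun j hj => ?_
        have h1 : L (r + j) ≤ w (r + j) := low_le b st w (r + j)
        rw [hz j (Finset.mem_range.1 hj)] at h1
        have : L (r + j) = 0 := by omega
        simp [this]
      rw [this, zero_add]
      exact pow_lt_one₀ hq.1.le (by linarith) (by omega)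
  have hb : ∀ m : ℕ, ∀ r, tv β L r ≤ 1 + k * (1 / 2) ^ m := by
    intro m
    induction m with
    | zero => intro r; have := tv_le_k hβ hLk r; simp; linarith
    | succ m ih =>
      intro r
      obtain ⟨n, hn, hk⟩ := key r
      rw [tv_split hβ hLk r n]
      have h1 := ih (r + n)
      have h2 : β⁻¹ ^ n ≤ 1 / 2 := by
        calc β⁻¹ ^ n ≤ β⁻¹ ^ 1 := pow_le_pow_of_le_one hq.1.le (by linarith) hn
          _ ≤ 1 / 2 := by simpa using hq.2
      have h3 : 0 < β⁻¹ ^ n := pow_pos hq.1 n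
      have h4 : β⁻¹ ^ n * tv β L (r + n) ≤ β⁻¹ ^ n * (1 + k * (1 / 2) ^ m) := by gcongr
      have h5 : β⁻¹ ^ n * (k * (1 / 2) ^ m) ≤ 1 / 2 * (k * (1 / 2) ^ m) := by gcongr
      rw [pow_succ]
      nlinarith
  have hle : ∀ r, tv β L r ≤ 1 := by
    intro r
    have : Tendsto (fun m : ℕ => 1 + (k : ℝ) * (1 / 2) ^ m) atTop (𝓝 (1 + k * 0)) :=
      ((tendsto_pow_atTop_nhds_zero_of_lt_one (by norm_num) (by norm_num)).const_mul _).const_add _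
    simpa using ge_of_tendsto' this (fun m => hb m r)
  refine ⟨hLk, fun r => ?_⟩
  obtain ⟨n, hn, hk⟩ := key r
  rw [tv_split hβ hLk r n]
  have h3 : 0 < β⁻¹ ^ n := pow_pos hq.1 n
  have := hle (r + n)
  nlinarith

lemma low_gap {k : ℕ} {β : ℝ} (hβ : 2 ≤ β) {N : ℕ} (hN : 0 < N) {v : Seq} (hv : v ∈ Adm k β)
    (r : ℕ) : tv β (low (fun s => s / N) (fun j => j * N) v) r ≤ 1 - β⁻¹ ^ (2 * N) := by
  have h := blk_div N hN
  set L := low (fun s => s / N) (fun j => j * N) v with hL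
  have hq := inv_bd hβ
  have hLk : ∀ r, L r < k := fun r => (low_le _ _ v r).trans_lt (hv.1 _)
  by_cases hz : ∃ j, j < N ∧ v (r + j) ≠ 0
  · obtain ⟨j, hj, hne⟩ := hz
    obtain ⟨t, ht1, ht2, ht3⟩ := low_exists h v (r + j) hne
    have ht4 : t < r + 2 * N := by
      have := Nat.div_mul_le_self (r + j) N
      have e : ((r + j) / N + 1) * N = (r + j) / N * N + N := by ring
      simp only [e] at ht2
      omega
    have hl := sum_lower hβ (v := v) (w := L) r r (2 * N)
        (fun i hi => low_le _ _ _ _) (t - r) (by omega)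
        (by rw [show r + (t - r) = t by omega]; exact ht3)
    have h1 := tv_split hβ hLk r (2 * N)
    have h2 := tv_split hβ hv.1 r (2 * N)
    have h3 := tv_mono hβ hv.1 (fun s => low_le (fun s => s / N) (fun j => j * N) v s) (r + 2 * N)
    have h4 : β⁻¹ ^ (2 * N) * tv β L (r + 2 * N) ≤ β⁻¹ ^ (2 * N) * tv β v (r + 2 * N) := by
      have := hq.1
      gcongr
    have := hv.2 r
    linarith
  · push Not at hz
    have h2 := tv_split hβ hv.1 r N
    rw [Finset.sum_eq_zero (fun j hj => by simp [hz j (Finset.mem_range.1 hj)]), zero_add] at h2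
    have h3 := tv_mono hβ hv.1 (fun s => low_le (fun s => s / N) (fun j => j * N) v s) r
    have h4 : ∀ n, 0 < n → β⁻¹ ^ n ≤ 1 / 2 := fun n hn => by
      calc β⁻¹ ^ n ≤ β⁻¹ ^ 1 := pow_le_pow_of_le_one hq.1.le (by linarith) hn
        _ ≤ 1 / 2 := by simpa using hq.2
    have h5 := h4 N hN
    have h6 := h4 (2 * N) (by omega)
    have h7 := hv.2 (r + N)
    have h8 : 0 < β⁻¹ ^ N := pow_pos hq.1 N
    have : tv β L r ≤ tv β v r := h3
    nlinarith

/-- Passing from one base to a nearby one after lowering. -/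
lemma low_transfer {k : ℕ} {β β' : ℝ} (hβ : 2 ≤ β) (hβ' : 2 ≤ β') (hk' : β' ≤ k)
    {N : ℕ} (hN : 0 < N)
    (hd : k * |β - β'| < (k : ℝ)⁻¹ ^ (2 * N)) {v : Seq} (hv : v ∈ Adm k β') :
    low (fun s => s / N) (fun j => j * N) v ∈ Adm k β := by
  have hLk : ∀ r, low (fun s => s / N) (fun j => j * N) v r < k :=
    fun r => (low_le _ _ v r).trans_lt (hv.1 _)
  refine ⟨hLk, fun r => ?_⟩
  have h1 := low_gap hβ' hN hv r
  have h2 : (k : ℝ)⁻¹ ^ (2 * N) ≤ β'⁻¹ ^ (2 * N) := by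
    have : (k : ℝ)⁻¹ ≤ β'⁻¹ := inv_anti₀ (by linarith) hk'
    gcongr
  have h3 : tv β (low (fun s => s / N) (fun j => j * N) v) r ≤
      tv β' (low (fun s => s / N) (fun j => j * N) v) r + k * |β - β'| := by
    rcases le_total β β' with hb | hb
    · have := tv_change hβ hb hLk r
      rwa [abs_sub_comm, abs_of_nonneg (by linarith)]
    · have := tv_anti hβ' hb hLk r
      have : 0 ≤ k * |β - β'| := by positivity
      linarith
  linarith

/-! ### Counting digits -/

lemma dc_sum (w : Seq) (i n : ℕ) :
    digitCount w i n = ∑ s ∈ Finset.range n, if w s = i then 1 else 0 := by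
  unfold digitCount
  rw [Finset.card_filter]

lemma dc_add (w : Seq) (i a n : ℕ) :
    digitCount w i (a + n) = digitCount w i a + digitCount (fun s => w (a + s)) i n := by
  simp only [dc_sum]
  rw [Finset.sum_range_add]

lemma dc_le (w : Seq) (i n : ℕ) : digitCount w i n ≤ n := by
  unfold digitCount
  exact (Finset.card_filter_le _ _).trans (by simp)

lemma dc_congr (w v : Seq) (i n : ℕ) (h : ∀ s < n, w s = v s) :
    digitCount w i n = digitCount v i n := by
  simp only [dc_sum]
  refine Finset.sum_congr rfl fun s hs => ?_
  rw [h s (Finset.mem_range.1 hs)]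

lemma dc_low {b st : ℕ → ℕ} (h : Blk b st) (w : Seq) (i n : ℕ) :
    |(digitCount (low b st w) i n : ℝ) - digitCount w i n| ≤ b n + 1 := by
  set L := low b st w with hL
  let M := (Finset.range n).filter fun s => L s ≠ w s
  have hM : M.card ≤ b n + 1 := by
    have : M.card ≤ (Finset.range (b n + 1)).card := by
      have key : ∀ s t, s < t → L s ≠ w s → L t ≠ w t → b s = b t → False := by
        intro s t hst hs ht hb
        have h1 : w t = 0 := by
          by_contra h2
          apply hs
          simp only [hL, low]
          rw [if_neg]
          intro h3
          exact h2 (h3 t hst (by rw [hb]; exact h.lts t))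
        apply ht
        have : L t ≤ w t := low_le b st w t
        omega
      refine Finset.card_le_card_of_injOn b ?_ ?_
      · intro s hs
        have := (Finset.mem_filter.1 hs).1
        have h2 := h.bmono (Finset.mem_range.1 this).le
        simp only [Finset.coe_range, Set.mem_Iio]
        omega
      · intro s hs t ht hst
        have hs' := (Finset.mem_filter.1 hs).2
        have ht' := (Finset.mem_filter.1 ht).2
        rcases lt_trichotomy s t with h1 | h1 | h1
        · exact (key s t h1 hs' ht' hst).elim
        · exact h1
        · exact (key t s h1 ht' hs' hst.symm).elim
    simpa using this
  have h1 : digitCount L i n ≤ digitCount w i n + M.card := by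
    unfold digitCount
    refine (Finset.card_le_card ?_).trans (Finset.card_union_le _ _)
    intro s hs
    simp only [M, Finset.mem_union, Finset.mem_filter] at hs ⊢
    by_cases hh : L s = w s
    · left; rw [← hh]; exact hs
    · right; exact ⟨hs.1, hh⟩
  have h2 : digitCount w i n ≤ digitCount L i n + M.card := by
    unfold digitCount
    refine (Finset.card_le_card ?_).trans (Finset.card_union_le _ _)
    intro s hs
    simp only [M, Finset.mem_union, Finset.mem_filter] at hs ⊢
    by_cases hh : L s = w s
    · left; rw [hh]; exact hs
    · right; exact ⟨hs.1, hh⟩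
  have h1' : (digitCount L i n : ℝ) ≤ digitCount w i n + (b n + 1) := by
    exact_mod_cast h1.trans (by omega)
  have h2' : (digitCount w i n : ℝ) ≤ digitCount L i n + (b n + 1) := by
    exact_mod_cast h2.trans (by omega)
  rw [abs_le]
  constructor <;> linarith

lemma dc_cat_st {b st : ℕ → ℕ} (h : Blk b st) (u : ℕ → Seq) (i j : ℕ) :
    digitCount (cat b st u) i (st j) =
      ∑ l ∈ Finset.range j, digitCount (u l) i (st (l + 1) - st l) := by
  induction j with
  | zero => simp [h.st0, digitCount]
  | succ j ih =>
    have hlt := h.lt j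
    rw [Finset.sum_range_succ, ← ih, show st (j + 1) = st j + (st (j + 1) - st j) by omega,
      dc_add, show st j + (st (j + 1) - st j) - st j = st (j + 1) - st j by omega]
    congr 1
    refine dc_congr _ _ _ _ fun s hs => ?_
    have : b (st j + s) = j := h.uniq (by omega) (by omega)
    simp only [cat, this]
    congr 1
    omega

lemma dev_bd (w : Seq) (i n : ℕ) {a : ℝ} (h0 : 0 ≤ a) (h1 : a ≤ 1) :
    |(digitCount w i n : ℝ) - a * n| ≤ n := by
  have h2 : (digitCount w i n : ℝ) ≤ n := by exact_mod_cast dc_le w i n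
  have h3 : (0 : ℝ) ≤ digitCount w i n := by positivity
  have h4 : (0 : ℝ) ≤ n := by positivity
  rw [abs_le]
  constructor <;> nlinarith

lemma dev_cat {b st : ℕ → ℕ} (h : Blk b st) (u : ℕ → Seq) (i n : ℕ) {a : ℝ}
    (h0 : 0 ≤ a) (h1 : a ≤ 1) :
    |(digitCount (low b st (cat b st u)) i n : ℝ) - a * n| ≤
      ∑ l ∈ Finset.range (b n),
        |(digitCount (u l) i (st (l + 1) - st l) : ℝ) - a * ((st (l + 1) - st l : ℕ) : ℝ)|
      + ((n - st (b n) : ℕ) : ℝ) + (b n + 1) := by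
  have e1 := dc_low h (cat b st u) i n
  have hle := h.le n
  have e2 : (digitCount (cat b st u) i n : ℝ) = ∑ l ∈ Finset.range (b n),
      (digitCount (u l) i (st (l + 1) - st l) : ℝ) +
      digitCount (fun s => cat b st u (st (b n) + s)) i (n - st (b n)) := by
    have : n = st (b n) + (n - st (b n)) := by omega
    conv_lhs => rw [this, dc_add, dc_cat_st h]
    push_cast
    rfl
  have e3 : (n : ℝ) = ∑ l ∈ Finset.range (b n), ((st (l + 1) - st l : ℕ) : ℝ)
      + ((n - st (b n) : ℕ) : ℝ) := by
    have : ∀ m, ∑ l ∈ Finset.range m, (st (l + 1) - st l) = st m := by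
      intro m
      induction m with
      | zero => simp [h.st0]
      | succ m ih => rw [Finset.sum_range_succ, ih]; have := h.lt m; omega
    have h2 := this (b n)
    have : (∑ l ∈ Finset.range (b n), (st (l + 1) - st l)) + (n - st (b n)) = n := by omega
    exact_mod_cast this.symm
  have e4 := dev_bd (fun s => cat b st u (st (b n) + s)) i (n - st (b n)) h0 h1
  have e5 := Finset.abs_sum_le_sum_abs (fun l => (digitCount (u l) i (st (l + 1) - st l) : ℝ)
    - a * ((st (l + 1) - st l : ℕ) : ℝ)) (Finset.range (b n))
  rw [Finset.sum_sub_distrib, ← Finset.mul_sum] at e5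
  have e6 : (digitCount (cat b st u) i n : ℝ) - a * n = (∑ l ∈ Finset.range (b n),
      (digitCount (u l) i (st (l + 1) - st l) : ℝ) - a * ∑ l ∈ Finset.range (b n),
        ((st (l + 1) - st l : ℕ) : ℝ)) +
      (digitCount (fun s => cat b st u (st (b n) + s)) i (n - st (b n))
        - a * ((n - st (b n) : ℕ) : ℝ)) := by
    rw [e2]
    conv_lhs => rw [e3]
    ring
  have e7 := abs_add_le (∑ l ∈ Finset.range (b n),
      (digitCount (u l) i (st (l + 1) - st l) : ℝ) - a * ∑ l ∈ Finset.range (b n),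
        ((st (l + 1) - st l : ℕ) : ℝ))
      ((digitCount (fun s => cat b st u (st (b n) + s)) i (n - st (b n)) : ℝ)
        - a * ((n - st (b n) : ℕ) : ℝ))
  rw [← e6] at e7
  have e8 := abs_add_le ((digitCount (low b st (cat b st u)) i n : ℝ)
    - digitCount (cat b st u) i n) ((digitCount (cat b st u) i n : ℝ) - a * n)
  rw [sub_add_sub_cancel] at e8
  linarith

/-- Periodic repetition: a good word yields a sequence good at all large times. -/
lemma periodic_step {k : ℕ} {β : ℝ} (hβ : 2 ≤ β) {a : ℕ → ℝ} (ha : ∀ i, 0 ≤ a i ∧ a i ≤ 1)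
    (H : ∀ ε > 0, ∀ M0 : ℕ, ∃ v ∈ Adm k β, ∃ M ≥ M0, ∀ i < k,
      |(digitCount v i M : ℝ) - a i * M| ≤ ε * M) (ε : ℝ) (hε : 0 < ε) :
    ∃ v ∈ Adm k β, ∃ n0 : ℕ, ∀ n ≥ n0, ∀ i < k,
      |(digitCount v i n : ℝ) - a i * n| ≤ ε * n := by
  obtain ⟨M0, hM0⟩ := exists_nat_gt (1 / (ε / 4))
  obtain ⟨v, hv, M, hM, hd⟩ := H (ε / 4) (by linarith) (M0 + 1)
  have hMpos : 0 < M := by omega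
  obtain ⟨n0, hn0⟩ := exists_nat_gt ((M + 1) / (ε / 4))
  have hB := blk_div M hMpos
  refine ⟨_, cat_adm hβ hB (fun _ => v) (fun _ => hv), n0, fun n hn i hi => ?_⟩
  refine (dev_cat hB (fun _ => v) i n (ha i).1 (ha i).2).trans ?_
  have hlen : ∀ l : ℕ, (l + 1) * M - l * M = M := fun l => by rw [← Nat.sub_mul]; simp
  simp only [hlen, Finset.sum_const, Finset.card_range, nsmul_eq_mul]
  have h1 := hd i hi
  have h2 : ((n / M : ℕ) : ℝ) * M ≤ n := by exact_mod_cast Nat.div_mul_le_self n M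
  have h3 : ((n - n / M * M : ℕ) : ℝ) ≤ M := by
    have := Nat.lt_div_mul_add (a := n) hMpos
    exact_mod_cast (by omega : n - n / M * M ≤ M)
  have h4 : ((n / M : ℕ) : ℝ) * |(digitCount v i M : ℝ) - a i * M| ≤ ε / 4 * n := by
    calc ((n / M : ℕ) : ℝ) * |(digitCount v i M : ℝ) - a i * M|
        ≤ ((n / M : ℕ) : ℝ) * (ε / 4 * M) := by gcongr
      _ = ε / 4 * (((n / M : ℕ) : ℝ) * M) := by ring
      _ ≤ ε / 4 * n := by gcongr
  have h5 : ((M : ℝ) + 1) ≤ ε / 4 * n := by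
    rw [div_lt_iff₀ (by linarith)] at hn0
    have : (n0 : ℝ) ≤ n := by exact_mod_cast hn
    nlinarith
  have h6 : ((n / M : ℕ) : ℝ) ≤ ε / 4 * n := by
    rw [div_lt_iff₀ (by linarith)] at hM0
    have : (M0 : ℝ) + 1 ≤ M := by exact_mod_cast hM
    have h7 : 1 ≤ ε / 4 * M := by nlinarith
    calc ((n / M : ℕ) : ℝ) = ((n / M : ℕ) : ℝ) * 1 := by ring
      _ ≤ ((n / M : ℕ) : ℝ) * (ε / 4 * M) := by gcongr
      _ = ε / 4 * (((n / M : ℕ) : ℝ) * M) := by ring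
      _ ≤ ε / 4 * n := by gcongr
  have h8 : 0 ≤ ε / 4 * n := by positivity
  linarith

/-- Key lemma: approximable frequency vectors are realised exactly. -/
lemma key_freq {k : ℕ} {β : ℝ} (hβ : 2 ≤ β) {a : ℕ → ℝ} (ha : ∀ i, 0 ≤ a i ∧ a i ≤ 1)
    (H : ∀ ε > 0, ∀ M0 : ℕ, ∃ v ∈ Adm k β, ∃ M ≥ M0, ∀ i < k,
      |(digitCount v i M : ℝ) - a i * M| ≤ ε * M) :
    ∃ w ∈ Adm k β, ∀ i < k,
      Tendsto (fun r => (digitCount w i r : ℝ) / (r : ℝ)) atTop (𝓝 (a i)) := by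
  have H1 : ∀ m : ℕ, ∃ v ∈ Adm k β, ∃ n0 : ℕ, ∀ n ≥ n0, ∀ i < k,
      |(digitCount v i n : ℝ) - a i * n| ≤ 1 / ((m : ℝ) + 1) * n :=
    fun m => periodic_step hβ ha H _ (by positivity)
  choose V hV n0 hn0 using H1
  let idx : ℕ → ℕ := fun l => Nat.findGreatest (fun m => n0 m ≤ 2 * l + 1) l
  let u : ℕ → Seq := fun l => V (idx l)
  have hu : ∀ m : ℕ, ∀ l ≥ max m (n0 m), ∀ i < k,
      |(digitCount (u l) i (2 * l + 1) : ℝ) - a i * ((2 * l + 1 : ℕ) : ℝ)| ≤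
        1 / ((m : ℝ) + 1) * ((2 * l + 1 : ℕ) : ℝ) := by
    intro m l hl i hi
    have hm : m ≤ l := (le_max_left _ _).trans hl
    have hn : n0 m ≤ 2 * l + 1 := by have := (le_max_right m (n0 m)).trans hl; omega
    have h1 : m ≤ idx l := Nat.le_findGreatest hm hn
    have h2 : n0 (idx l) ≤ 2 * l + 1 :=
      Nat.findGreatest_spec (P := fun m => n0 m ≤ 2 * l + 1) hm hn
    refine (hn0 (idx l) _ h2 i hi).trans ?_
    have : (m : ℝ) ≤ idx l := by exact_mod_cast h1
    gcongr
  have hB := blk_sqrt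
  refine ⟨_, cat_adm hβ hB u (fun l => hV _), fun i hi => ?_⟩
  set w := low Nat.sqrt (fun j => j * j) (cat Nat.sqrt (fun j => j * j) u) with hw
  have hlen : ∀ l : ℕ, (l + 1) * (l + 1) - l * l = 2 * l + 1 := fun l => by
    have : (l + 1) * (l + 1) = l * l + (2 * l + 1) := by ring
    omega
  rw [Metric.tendsto_atTop]
  intro ε hε
  obtain ⟨m, hm⟩ := exists_nat_gt (1 / (ε / 4))
  let l0 := max m (n0 m)
  have hsum : ∀ j, ∑ l ∈ Finset.range j,
      |(digitCount (u l) i (2 * l + 1) : ℝ) - a i * ((2 * l + 1 : ℕ) : ℝ)| ≤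
      l0 * l0 + 1 / ((m : ℝ) + 1) * (j * j) := by
    intro j
    have hA : ∀ l, |(digitCount (u l) i (2 * l + 1) : ℝ) - a i * ((2 * l + 1 : ℕ) : ℝ)| ≤
        (if l < l0 then ((2 * l + 1 : ℕ) : ℝ) else 0) +
          1 / ((m : ℝ) + 1) * ((2 * l + 1 : ℕ) : ℝ) := by
      intro l
      split_ifs with hl
      · have := dev_bd (u l) i (2 * l + 1) (ha i).1 (ha i).2
        have h2 : 0 ≤ 1 / ((m : ℝ) + 1) * ((2 * l + 1 : ℕ) : ℝ) := by positivity
        linarith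
      · rw [zero_add]
        exact hu m l (not_lt.1 hl) i hi
    have hs : ∀ j : ℕ, ∑ l ∈ Finset.range j, ((2 * l + 1 : ℕ) : ℝ) = j * j := by
      intro j
      induction j with
      | zero => simp
      | succ j ih => rw [Finset.sum_range_succ, ih]; push_cast; ring
    refine (Finset.sum_le_sum fun l _ => hA l).trans ?_
    rw [Finset.sum_add_distrib, ← Finset.mul_sum, hs, ← Finset.sum_filter]
    gcongr
    rw [← hs]
    refine Finset.sum_le_sum_of_subset_of_nonneg ?_ (fun _ _ _ => by positivity)
    intro l hl
    simpa using (Finset.mem_filter.1 hl).2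
  obtain ⟨n1, hn1⟩ := exists_nat_gt ((l0 * l0 + 2) / (ε / 4))
  obtain ⟨n2, hn2⟩ := exists_nat_gt (3 / (ε / 4))
  refine ⟨max (n1 + 1) (n2 * n2 + 1), fun n hn => ?_⟩
  have hn1' : n1 + 1 ≤ n := (le_max_left _ _).trans hn
  have hn2' : n2 * n2 + 1 ≤ n := (le_max_right _ _).trans hn
  have hnpos : (0 : ℝ) < n := by exact_mod_cast (by omega : 0 < n)
  have hq := Nat.sqrt_le n
  have hq2 := Nat.sqrt_le_add n
  have hdev := dev_cat hB u i n (ha i).1 (ha i).2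
  simp only [hlen] at hdev
  rw [← hw] at hdev
  have b1 := hsum (Nat.sqrt n)
  have b2 : ((n - Nat.sqrt n * Nat.sqrt n : ℕ) : ℝ) ≤ 2 * Nat.sqrt n := by
    exact_mod_cast (by omega : n - Nat.sqrt n * Nat.sqrt n ≤ 2 * Nat.sqrt n)
  have hqr : (Nat.sqrt n : ℝ) * Nat.sqrt n ≤ n := by exact_mod_cast hq
  have b3 : 1 / ((m : ℝ) + 1) * (Nat.sqrt n * Nat.sqrt n) ≤ ε / 4 * n := by
    have : 1 / ((m : ℝ) + 1) ≤ ε / 4 := by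
      rw [div_lt_iff₀ (by linarith)] at hm
      rw [div_le_iff₀ (by positivity)]
      nlinarith
    gcongr
  have b4 : (l0 : ℝ) * l0 + 2 ≤ ε / 4 * n := by
    rw [div_lt_iff₀ (by linarith)] at hn1
    have : (n1 : ℝ) + 1 ≤ n := by exact_mod_cast hn1'
    nlinarith
  have b5 : 3 * (Nat.sqrt n : ℝ) ≤ ε / 4 * n := by
    rw [div_lt_iff₀ (by linarith)] at hn2
    have h1 : n2 ≤ Nat.sqrt n := by
      rw [Nat.le_sqrt]; omega
    have h2 : (n2 : ℝ) ≤ Nat.sqrt n := by exact_mod_cast h1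
    have h3 : 3 ≤ ε / 4 * Nat.sqrt n := by nlinarith
    calc 3 * (Nat.sqrt n : ℝ) ≤ ε / 4 * Nat.sqrt n * Nat.sqrt n := by gcongr
      _ = ε / 4 * (Nat.sqrt n * Nat.sqrt n) := by ring
      _ ≤ ε / 4 * n := by gcongr
  have b6 : |(digitCount w i n : ℝ) - a i * n| < ε * n := by
    have : 0 < ε / 4 * n := by positivity
    linarith
  rw [Real.dist_eq, show (digitCount w i n : ℝ) / n - a i = (digitCount w i n - a i * n) / n by
    field_simp, abs_div, abs_of_pos hnpos, div_lt_iff₀ hnpos]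
  exact b6

/-! ### The digit frequency sets -/

/-- Digit frequencies of admissible sequences. -/
def DD (k : ℕ) (β : ℝ) : Set (E k) := {α | α ∈ simplex k ∧ ∃ v ∈ Adm k β, HasDigitFreq k v α}

lemma proj_bd {k : ℕ} {α : E k} (hα : α ∈ simplex k) (i : ℕ) : 0 ≤ proj α i ∧ proj α i ≤ 1 := by
  unfold proj
  split_ifs with h
  · refine ⟨hα.1 _, ?_⟩
    rw [← hα.2]
    exact Finset.single_le_sum (f := fun i => α i) (fun i _ => hα.1 i) (Finset.mem_univ _)
  · simp

lemma freq_unif {k : ℕ} {v : Seq} {α : E k} (h : HasDigitFreq k v α) (ε : ℝ) (hε : 0 < ε) :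
    ∃ n0 : ℕ, ∀ n ≥ n0, ∀ i < k, |(digitCount v i n : ℝ) - proj α i * n| ≤ ε * n := by
  have h1 : ∀ᶠ n : ℕ in atTop, ∀ i ∈ Finset.range k,
      dist ((digitCount v i n : ℝ) / n) (proj α i) < ε := by
    rw [Filter.eventually_all_finset]
    intro i hi
    exact (Metric.tendsto_nhds.1 (h i (Finset.mem_range.1 hi))) ε hε
  obtain ⟨n0, hn0⟩ := Filter.eventually_atTop.1 (h1.and (eventually_gt_atTop 0))
  refine ⟨n0, fun n hn i hi => ?_⟩
  obtain ⟨h2, h3⟩ := hn0 n hn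
  have hnpos : (0 : ℝ) < n := by exact_mod_cast h3
  have h4 := h2 i (Finset.mem_range.2 hi)
  rw [Real.dist_eq, show (digitCount v i n : ℝ) / n - proj α i
    = (digitCount v i n - proj α i * n) / n by
    field_simp, abs_div, abs_of_pos hnpos, div_lt_iff₀ hnpos] at h4
  exact h4.le

lemma dd_of_approx {k : ℕ} {β : ℝ} (hβ : 2 ≤ β) {α : E k} (hα : α ∈ simplex k)
    (H : ∀ ε > 0, ∀ M0 : ℕ, ∃ v ∈ Adm k β, ∃ M ≥ M0, ∀ i < k,
      |(digitCount v i M : ℝ) - proj α i * M| ≤ ε * M) : α ∈ DD k β :=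
  ⟨hα, key_freq hβ (proj_bd hα) H⟩

lemma simplex_closed (k : ℕ) : IsClosed (simplex k) := by
  have : simplex k = (⋂ i : Fin k, {α : E k | 0 ≤ α i}) ∩ {α : E k | ∑ i, α i = 1} := by
    ext α; simp [simplex]
  rw [this]
  refine (isClosed_iInter fun i => ?_).inter ?_
  · exact isClosed_le continuous_const (by fun_prop)
  · exact isClosed_eq (by fun_prop) continuous_const

lemma dist_bd {k : ℕ} {α γ : E k} {c : ℝ} (hc : 0 ≤ c) (h : ∀ i, |α i - γ i| ≤ c) :
    dist α γ ≤ k * c := by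
  rw [EuclideanSpace.dist_eq]
  refine Real.sqrt_le_iff.2 ⟨by positivity, ?_⟩
  calc ∑ i, dist (α i) (γ i) ^ 2 ≤ ∑ _i : Fin k, c ^ 2 := by
        refine Finset.sum_le_sum fun i _ => ?_
        rw [Real.dist_eq]
        exact pow_le_pow_left₀ (abs_nonneg _) (h i) 2
    _ = k * c ^ 2 := by simp
    _ ≤ (k * c) ^ 2 := by
        have : (k : ℝ) ≤ k ^ 2 := by
          have : k ≤ k ^ 2 := Nat.le_self_pow (by norm_num) k
          exact_mod_cast this
        nlinarith [sq_nonneg c]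

lemma coord_le_dist {k : ℕ} (α γ : E k) (i : Fin k) : |α i - γ i| ≤ dist α γ := by
  rw [EuclideanSpace.dist_eq, ← Real.dist_eq]
  refine Real.le_sqrt_of_sq_le ?_
  exact Finset.single_le_sum (f := fun i => dist (α i) (γ i) ^ 2)
    (fun i _ => sq_nonneg _) (Finset.mem_univ i)

lemma simplex_compact (k : ℕ) : IsCompact (simplex k) := by
  refine Metric.isCompact_of_isClosed_isBounded (simplex_closed k) ?_
  refine (Metric.isBounded_iff).2 ⟨k * 1, fun α hα γ hγ => dist_bd zero_le_one fun i => ?_⟩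
  have h1 := proj_bd hα i
  have h2 := proj_bd hγ i
  simp only [proj, i.2, dif_pos] at h1 h2
  rw [abs_le]
  constructor <;> linarith [h1.1, h1.2, h2.1, h2.2]

lemma proj_le_dist {k : ℕ} (α γ : E k) (i : ℕ) : |proj α i - proj γ i| ≤ dist α γ := by
  unfold proj
  split_ifs with h
  · exact coord_le_dist α γ ⟨i, h⟩
  · simp

lemma dd_closed {k : ℕ} {β : ℝ} (hβ : 2 ≤ β) : IsClosed (DD k β) := by
  refine isClosed_of_closure_subset fun α hα => ?_
  have hs : α ∈ simplex k := closure_minimal (fun γ hγ => hγ.1) (simplex_closed k) hα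
  refine dd_of_approx hβ hs fun ε hε M0 => ?_
  obtain ⟨γ, hγ, hd⟩ := Metric.mem_closure_iff.1 hα (ε / 2) (by linarith)
  obtain ⟨v, hv, hf⟩ := hγ.2
  obtain ⟨n0, hn0⟩ := freq_unif hf (ε / 2) (by linarith)
  refine ⟨v, hv, max n0 M0, le_max_right _ _, fun i hi => ?_⟩
  set M := max n0 M0
  have h1 := hn0 M (le_max_left _ _) i hi
  have h2 := proj_le_dist α γ i
  have h3 : |(proj γ i - proj α i) * (M : ℝ)| ≤ ε / 2 * M := by
    rw [abs_mul, abs_of_nonneg (by positivity : (0 : ℝ) ≤ M), abs_sub_comm]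
    have : |proj α i - proj γ i| ≤ ε / 2 := h2.trans hd.le
    gcongr
  calc |(digitCount v i M : ℝ) - proj α i * M|
      = |((digitCount v i M : ℝ) - proj γ i * M) + (proj γ i - proj α i) * M| := by ring_nf
    _ ≤ _ := abs_add_le _ _
    _ ≤ ε * M := by linarith

lemma freqVec_simplex {k : ℕ} {v : Seq} (hv : ∀ r, v r < k) {n : ℕ} (hn : 0 < n) :
    freqVec k v n ∈ simplex k := by
  refine ⟨fun i => ?_, ?_⟩
  · show 0 ≤ (digitCount v (i : ℕ) n : ℝ) / (n : ℝ)
    positivity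
  · show ∑ i : Fin k, (digitCount v (i : ℕ) n : ℝ) / (n : ℝ) = 1
    rw [← Finset.sum_div, div_eq_one_iff_eq (by exact_mod_cast hn.ne')]
    have : ∑ i : Fin k, digitCount v (i : ℕ) n = n := by
      simp only [dc_sum]
      rw [Finset.sum_comm]
      have : ∀ s, ∑ i : Fin k, (if v s = (i : ℕ) then 1 else 0) = 1 := by
        intro s
        rw [Finset.sum_eq_single ⟨v s, hv s⟩]
        · simp
        · intro i _ hi
          rw [if_neg]
          intro h
          exact hi (Fin.ext h.symm)
        · simp
      simp [this]
    exact_mod_cast this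

lemma dd_near {k : ℕ} {β β' : ℝ} (hβ : 2 ≤ β) (hβ' : 2 ≤ β') (hk' : β' ≤ k)
    {N : ℕ} (hN : 0 < N) (hd : k * |β - β'| < (k : ℝ)⁻¹ ^ (2 * N)) {α : E k}
    (hα : α ∈ DD k β') : ∃ γ ∈ DD k β, dist α γ ≤ k * (3 / N) := by
  obtain ⟨hs, v, hv, hf⟩ := hα
  set L := low (fun s => s / N) (fun j => j * N) v with hL
  have hLA : L ∈ Adm k β := low_transfer hβ hβ' hk' hN hd hv
  have hNr : (0 : ℝ) < N := by exact_mod_cast hN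
  obtain ⟨n0, hn0⟩ := freq_unif hf (1 / N) (by positivity)
  obtain ⟨γ, hγ, φ, hφ, hlim⟩ := (simplex_compact k).tendsto_subseq
    (x := fun n => freqVec k L (n + 1)) (fun n => freqVec_simplex hLA.1 n.succ_pos)
  have hcoord : ∀ i : Fin k, Tendsto (fun n => (digitCount L (i : ℕ) (φ n + 1) : ℝ) /
      ((φ n + 1 : ℕ) : ℝ)) atTop (𝓝 (γ i)) := by
    intro i
    have hc : Continuous (fun x : E k => x i) := by fun_prop
    exact (hc.tendsto γ).comp hlim
  have hφ1 : ∀ n, n ≤ φ n := hφ.id_le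
  refine ⟨γ, dd_of_approx hβ hγ fun ε hε M0 => ?_, dist_bd (by positivity) fun i => ?_⟩
  · have h1 : ∀ᶠ n : ℕ in atTop, ∀ i : Fin k, dist ((digitCount L (i : ℕ) (φ n + 1) : ℝ) /
      ((φ n + 1 : ℕ) : ℝ)) (γ i) < ε := by
      rw [Filter.eventually_all]
      intro i
      exact (Metric.tendsto_nhds.1 (hcoord i)) ε hε
    obtain ⟨n, h2, h3⟩ := (h1.and (eventually_ge_atTop M0)).exists
    refine ⟨L, hLA, φ n + 1, by have := hφ1 n; omega, fun i hi => ?_⟩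
    have h4 := h2 ⟨i, hi⟩
    have hnpos : (0 : ℝ) < ((φ n + 1 : ℕ) : ℝ) := by positivity
    simp only [proj, hi, dif_pos]
    rw [Real.dist_eq, show (digitCount L i (φ n + 1) : ℝ) / ((φ n + 1 : ℕ) : ℝ) - γ ⟨i, hi⟩
      = (digitCount L i (φ n + 1) - γ ⟨i, hi⟩ * ((φ n + 1 : ℕ) : ℝ)) / ((φ n + 1 : ℕ) : ℝ) by
      field_simp, abs_div, abs_of_pos hnpos, div_lt_iff₀ hnpos] at h4
    exact h4.le
  · have h1 : Tendsto (fun n => |α i - (digitCount L (i : ℕ) (φ n + 1) : ℝ) /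
      ((φ n + 1 : ℕ) : ℝ)|) atTop (𝓝 |α i - γ i|) := ((hcoord i).const_sub _).abs
    refine le_of_tendsto h1 ?_
    filter_upwards [eventually_ge_atTop (max n0 N)] with n hn
    set M := φ n + 1 with hM
    have hnM : n ≤ M := by have := hφ1 n; omega
    have h2 := hn0 M (((le_max_left _ _).trans hn).trans hnM) i i.2
    have h3 : N ≤ M := ((le_max_right _ _).trans hn).trans hnM
    have h3' : (N : ℝ) ≤ M := by exact_mod_cast h3
    have h4 := dc_low (blk_div N hN) v i M
    have hMpos : (0 : ℝ) < M := by linarith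
    have h5 : ((M / N : ℕ) : ℝ) ≤ M / N := Nat.cast_div_le
    have h6 : (1 : ℝ) ≤ M / N := by rwa [le_div_iff₀ hNr, one_mul]
    simp only [proj, i.2, dif_pos, Fin.eta] at h2
    have h7 := abs_add_le ((digitCount L (i : ℕ) M : ℝ) - digitCount v i M)
      ((digitCount v i M : ℝ) - α i * M)
    rw [sub_add_sub_cancel] at h7
    rw [abs_sub_comm, show (digitCount L i M : ℝ) / M - α i = (digitCount L i M - α i * M) / M by
      field_simp, abs_div, abs_of_pos hMpos, div_le_iff₀ hMpos]
    have e1 : 1 / (N : ℝ) * M = M / N := by ring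
    have e2 : 3 / (N : ℝ) * M = M / N + M / N + M / N := by ring
    rw [e1] at h2
    rw [e2]
    linarith

lemma dd_mono {k : ℕ} {β β' : ℝ} (hβ : 2 ≤ β) (hb : β ≤ β') : DD k β ⊆ DD k β' := by
  rintro α ⟨hs, v, hv, hf⟩
  exact ⟨hs, v, ⟨hv.1, fun r => (tv_anti hβ hb hv.1 r).trans_lt (hv.2 r)⟩, hf⟩

/-! ### Comparison with the greedy expansions -/

lemma dd_eq {k : ℕ} {β : ℝ} (hβ : 2 ≤ β) (hk' : β ≤ k) : DFbeta k β = DD k β := by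
  have hq := inv_bd hβ
  have hβ0 : β ≠ 0 := by linarith
  ext α
  constructor
  · rintro ⟨hs, x, hx, hf⟩
    refine ⟨hs, fun r => dbeta β x (r + 1), ?_, ?_⟩
    · let y : ℕ → ℝ := fun r => (fbeta β)^[r + 1] x
      have hy : ∀ r, 0 ≤ y r ∧ y r < 1 := by
        intro r
        simp only [y, Function.iterate_succ_apply']
        exact ⟨Int.fract_nonneg _, Int.fract_lt_one _⟩
      have hyn : ∀ r, 0 ≤ β * y r := fun r => mul_nonneg (by linarith) (hy r).1
      have hstep : ∀ r, β * y r = (dbeta β x (r + 1) : ℝ) + y (r + 1) := by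
        intro r
        have e1 : y (r + 1) = Int.fract (β * y r) := by
          simp only [y]
          rw [Function.iterate_succ_apply' (fbeta β) (r + 1)]
          rfl
        have e2 : dbeta β x (r + 1) = ⌊β * y r⌋₊ := rfl
        rw [e1, e2, natCast_floor_eq_intCast_floor (hyn r), Int.floor_add_fract]
      have hsum : ∀ n r, ∑ j ∈ Finset.range n, (dbeta β x (r + j + 1) : ℝ) * β⁻¹ ^ (j + 1)
          + β⁻¹ ^ n * y (r + n) = y r := by
        intro n r
        induction n with
        | zero => simp
        | succ n ih =>
          rw [Finset.sum_range_succ, ← ih]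
          have := hstep (r + n)
          have e : y (r + (n + 1)) = β * y (r + n) - dbeta β x (r + n + 1) := by
            rw [this]; ring_nf
          rw [e, pow_succ]
          field_simp
          ring
      refine ⟨fun r => ?_, fun r => ?_⟩
      · have h1 := hstep r
        have h2 := hy r
        have h3 := hy (r + 1)
        have : (dbeta β x (r + 1) : ℝ) < k := by nlinarith
        exact_mod_cast this
      · refine lt_of_le_of_lt ?_ (hy r).2
        refine Real.tsum_le_of_sum_range_le (fun j => ?_) (fun n => ?_)
        · have := hq.1
          positivity
        · have h1 := hsum n r
          have h2 : 0 ≤ β⁻¹ ^ n * y (r + n) := mul_nonneg (pow_nonneg hq.1.le _) (hy _).1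
          show ∑ j ∈ Finset.range n, (dbeta β x (r + j + 1) : ℝ) * β⁻¹ ^ (j + 1) ≤ y r
          linarith
    · intro i hi
      have h1 := hf i hi
      have hdiff : Tendsto (fun n : ℕ => ((digitCount (fun r => dbeta β x (r + 1)) i n : ℝ)
          - digitCount (dbeta β x) i n) / n) atTop (𝓝 0) := by
        refine squeeze_zero_norm (a := fun n : ℕ => 1 / (n : ℝ)) (fun n => ?_)
          tendsto_one_div_atTop_nhds_zero_nat
        rw [norm_div, Real.norm_natCast]
        gcongr
        have a1 : digitCount (dbeta β x) i (1 + n) = digitCount (dbeta β x) i 1 +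
          digitCount (fun r => dbeta β x (r + 1)) i n := by
          rw [dc_add]
          simp only [Nat.add_comm 1]
        have a2 := dc_add (dbeta β x) i n 1
        have a3 := dc_le (dbeta β x) i 1
        have a4 := dc_le (fun s => dbeta β x (n + s)) i 1
        rw [Nat.add_comm 1 n] at a1
        rw [Real.norm_eq_abs, abs_le]
        have b1 : (digitCount (fun r => dbeta β x (r + 1)) i n : ℝ) ≤
            digitCount (dbeta β x) i n + 1 := by exact_mod_cast (by omega)
        have b2 : (digitCount (dbeta β x) i n : ℝ) ≤
            digitCount (fun r => dbeta β x (r + 1)) i n + 1 := by exact_mod_cast (by omega)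
        constructor <;> linarith
      have := hdiff.add h1
      rw [zero_add] at this
      refine this.congr fun n => ?_
      ring
  · rintro ⟨hs, v, hv, hf⟩
    have hx : ∀ r, (fbeta β)^[r] (tv β v 0) = tv β v r := by
      intro r
      induction r with
      | zero => rfl
      | succ r ih =>
        rw [Function.iterate_succ_apply', ih, fbeta, tv_step hβ hv.1 r, Int.fract_natCast_add,
          Int.fract_eq_self.2 ⟨tv_nonneg hβ v _, hv.2 _⟩]
    have hdv : dbeta β (tv β v 0) = v := by
      funext r
      show ⌊β * (fbeta β)^[r] (tv β v 0)⌋₊ = v r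
      rw [hx, tv_step hβ hv.1 r, Nat.floor_eq_iff (by have := tv_nonneg hβ v (r + 1); positivity)]
      have h1 := tv_nonneg hβ v (r + 1)
      have h2 := hv.2 (r + 1)
      constructor <;> linarith
    exact ⟨hs, tv β v 0, ⟨tv_nonneg hβ v 0, (hv.2 0).le⟩, by rw [hdv]; exact hf⟩

/-! ### Integer bases -/

lemma int_adm {k d : ℕ} (hd : 2 ≤ d) (hdk : d ≤ k) {v : Seq} (hv : ∀ r, v r < d) (M : ℕ)
    (hM : ∀ r ≥ M, v r = 0) : v ∈ Adm k d := by
  have hβ : (2 : ℝ) ≤ (d : ℝ) := by exact_mod_cast hd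
  have hvk : ∀ r, v r < k := fun r => (hv r).trans_le hdk
  have hq := inv_bd hβ
  refine ⟨hvk, fun r => ?_⟩
  rw [tv_split hβ hvk r M]
  have h0 : tv d v (r + M) = 0 := by
    unfold tv
    simp [fun j => hM (r + M + j) (by omega)]
  have hd0 : (d : ℝ) ≠ 0 := by linarith
  have hs : ∀ n, ∑ j ∈ Finset.range n, ((d : ℝ) - 1) * (d : ℝ)⁻¹ ^ (j + 1) = 1 - (d : ℝ)⁻¹ ^ n := by
    intro n
    induction n with
    | zero => simp
    | succ n ih =>
      rw [Finset.sum_range_succ, ih, pow_succ]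
      field_simp
      ring
  have h1 : ∑ j ∈ Finset.range M, (v (r + j) : ℝ) * (d : ℝ)⁻¹ ^ (j + 1) ≤
      ∑ j ∈ Finset.range M, ((d : ℝ) - 1) * (d : ℝ)⁻¹ ^ (j + 1) := by
    refine Finset.sum_le_sum fun j _ => ?_
    have : (v (r + j) : ℝ) + 1 ≤ d := by exact_mod_cast hv (r + j)
    gcongr
    linarith
  rw [hs] at h1
  have h2 : 0 < (d : ℝ)⁻¹ ^ M := pow_pos hq.1 M
  rw [h0]
  linarith

lemma int_dd {k d : ℕ} (hd : 2 ≤ d) (hdk : d ≤ k) {α : E k} (hα : α ∈ simplex k)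
    (h0 : ∀ i, d ≤ i → proj α i = 0) : α ∈ DD k d := by
  have hβ : (2 : ℝ) ≤ (d : ℝ) := by exact_mod_cast hd
  refine dd_of_approx hβ hα fun ε hε M0 => ?_
  obtain ⟨M1, hM1⟩ := exists_nat_gt (1 / ε)
  set M := max M0 M1 + 1 with hM
  let S : ℕ → ℝ := fun i => ∑ j ∈ Finset.range i, proj α j
  have hSmono : Monotone S := monotone_nat_of_le_succ fun i => by
    simp only [S, Finset.sum_range_succ]
    linarith [(proj_bd hα i).1]
  have hSd : S d = 1 := by
    have e1 : S k = 1 := by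
      simp only [S]
      rw [← hα.2, Finset.sum_range]
      exact Finset.sum_congr rfl fun i _ => by simp [proj]
    rw [← e1]
    refine Finset.sum_subset (Finset.range_mono hdk) fun i _ hi => ?_
    exact h0 i (by simpa using hi)
  have hS0 : ∀ i, 0 ≤ S i := fun i => Finset.sum_nonneg fun j _ => (proj_bd hα j).1
  let m : ℕ → ℕ := fun i => ⌊S i * M⌋₊
  have hm : Monotone m := fun i j hij => Nat.floor_mono (by have := hSmono hij; gcongr)
  have hmd : m d = M := by simp [m, hSd]
  have hm0 : m 0 = 0 := by simp [m, S]
  let v : Seq := fun s => if s < M then Nat.findGreatest (fun i => m i ≤ s) (d - 1) else 0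
  have hvd : ∀ r, v r < d := by
    intro r
    simp only [v]
    split_ifs
    · have := Nat.findGreatest_le (P := fun i => m i ≤ r) (d - 1)
      omega
    · omega
  refine ⟨v, int_adm hd hdk hvd M (fun r hr => by simp [v, not_lt.2 hr]), M, by omega,
    fun i hi => ?_⟩
  have hMr : (0 : ℝ) < M := by positivity
  have hεM : 1 ≤ ε * M := by
    rw [div_lt_iff₀ hε] at hM1
    have : (M1 : ℝ) ≤ M := by exact_mod_cast (by omega : M1 ≤ M)
    nlinarith
  by_cases hid : d ≤ i
  · have : digitCount v i M = 0 := by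
      unfold digitCount
      rw [Finset.card_eq_zero, Finset.filter_eq_empty_iff]
      intro s _ h
      have := hvd s
      omega
    rw [this, h0 i hid]
    simp
    positivity
  · have hc : digitCount v i M = m (i + 1) - m i := by
      unfold digitCount
      rw [← Nat.card_Ico]
      congr 1
      ext s
      simp only [Finset.mem_filter, Finset.mem_range, Finset.mem_Ico]
      have hmi : m (i + 1) ≤ M := by rw [← hmd]; exact hm (by omega)
      constructor
      · rintro ⟨hs, hvs⟩
        simp only [v, hs, if_true] at hvs
        rw [Nat.findGreatest_eq_iff] at hvs
        refine ⟨?_, ?_⟩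
        · by_cases h : i = 0
          · rw [h, hm0]; omega
          · exact hvs.2.1 h
        · by_cases h : i + 1 = d
          · rw [h, hmd]; exact hs
          · exact not_le.1 (hvs.2.2 (Nat.lt_succ_self i) (by omega))
      · rintro ⟨h1, h2⟩
        have hs : s < M := by omega
        refine ⟨hs, ?_⟩
        simp only [v, hs, if_true]
        rw [Nat.findGreatest_eq_iff]
        refine ⟨by omega, fun _ => h1, fun n hn _ => ?_⟩
        have := hm (show i + 1 ≤ n from hn)
        omega
    have hle := hm (Nat.le_succ i)
    rw [hc, Nat.cast_sub hle]
    have f1 := Nat.floor_le (mul_nonneg (hS0 i) hMr.le)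
    have f2 := Nat.lt_floor_add_one (S i * M)
    have f3 := Nat.floor_le (mul_nonneg (hS0 (i + 1)) hMr.le)
    have f4 := Nat.lt_floor_add_one (S (i + 1) * M)
    have f5 : S (i + 1) = S i + proj α i := by simp only [S, Finset.sum_range_succ]
    have f6 : S (i + 1) * M = S i * M + proj α i * M := by rw [f5]; ring
    have g1 : ((m i : ℕ) : ℝ) = (⌊S i * M⌋₊ : ℝ) := rfl
    have g2 : ((m (i + 1) : ℕ) : ℝ) = (⌊S (i + 1) * M⌋₊ : ℝ) := rfl
    rw [Nat.succ_eq_add_one, g1, g2, abs_le]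
    constructor <;> linarith

lemma dd_top {k : ℕ} (hk : 3 ≤ k) : DD k (k : ℝ) = simplex k := by
  refine Set.Subset.antisymm (fun α h => h.1) fun α hα => ?_
  exact int_dd (by omega) le_rfl hα fun i hi => by simp [proj, not_lt.2 hi]

lemma dd_bot {k : ℕ} (hk : 3 ≤ k) : DD k ((k : ℝ) - 1) = faceF k := by
  have e : ((k - 1 : ℕ) : ℝ) = (k : ℝ) - 1 := by
    rw [Nat.cast_sub (by omega)]; simp
  have hβ : (2 : ℝ) ≤ (k : ℝ) - 1 := by
    have : (3 : ℝ) ≤ k := by exact_mod_cast hk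
    linarith
  refine Set.Subset.antisymm ?_ ?_
  · rintro α ⟨hs, v, hv, hf⟩
    refine ⟨hs, ?_⟩
    have h1 : ∀ r, v r < k - 1 := by
      intro r
      have h2 := tv_step hβ hv.1 r
      have h3 := hv.2 r
      have h4 := tv_nonneg hβ v (r + 1)
      rw [← e] at h2 h3 h4 hβ
      have : (v r : ℝ) < ((k - 1 : ℕ) : ℝ) := by nlinarith
      exact_mod_cast this
    have h2 := hf (k - 1) (by omega)
    have h3 : ∀ n, digitCount v (k - 1) n = 0 := by
      intro n
      unfold digitCount
      rw [Finset.card_eq_zero, Finset.filter_eq_empty_iff]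
      intro s _ h
      have := h1 s
      omega
    simp only [h3, Nat.cast_zero, zero_div] at h2
    exact tendsto_nhds_unique h2 tendsto_const_nhds
  · rintro α ⟨hs, h0⟩
    rw [← e]
    refine int_dd (by omega) (by omega) hs fun i hi => ?_
    by_cases h : i = k - 1
    · rw [h]; exact h0
    · have : ¬ i < k := by omega
      simp [proj, this]

lemma dfext_eq {k : ℕ} (hk : 3 ≤ k) {β : ℝ} (hβ : β ∈ Set.Icc ((k : ℝ) - 1) k) :
    DFext k β = DD k β := by
  have h3 : (3 : ℝ) ≤ k := by exact_mod_cast hk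
  unfold DFext
  split_ifs with h1 h2
  · rw [le_antisymm h1 hβ.1, dd_bot hk]
  · rw [le_antisymm hβ.2 h2, dd_top hk]
  · exact dd_eq (by linarith [hβ.1]) hβ.2

/-! ### A continuous strictly monotone size function on compact sets -/

/-- A (decreasing) Whitney map on the hyperspace of nonempty compact sets. -/
noncomputable def whit (k : ℕ) (C : TopologicalSpace.NonemptyCompacts (E k)) : ℝ :=
  ∑' n : ℕ, (1 / 2 : ℝ) ^ n * min 1 (Metric.infDist (TopologicalSpace.denseSeq (E k) n) (C : Set (E k)))

lemma whit_bd (k : ℕ) (C : TopologicalSpace.NonemptyCompacts (E k)) (n : ℕ) :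
    ‖(1 / 2 : ℝ) ^ n * min 1 (Metric.infDist (TopologicalSpace.denseSeq (E k) n) (C : Set (E k)))‖
      ≤ (1 / 2 : ℝ) ^ n := by
  have h0 : 0 ≤ min 1 (Metric.infDist (TopologicalSpace.denseSeq (E k) n) (C : Set (E k))) :=
    le_min zero_le_one Metric.infDist_nonneg
  have h1 : min 1 (Metric.infDist (TopologicalSpace.denseSeq (E k) n) (C : Set (E k))) ≤ 1 :=
    min_le_left _ _
  rw [Real.norm_of_nonneg (by positivity)]
  exact mul_le_of_le_one_right (by positivity) h1

lemma half_summ : Summable (fun n : ℕ => (1 / 2 : ℝ) ^ n) := summable_geometric_two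

lemma whit_summ (k : ℕ) (C : TopologicalSpace.NonemptyCompacts (E k)) :
    Summable fun n : ℕ => (1 / 2 : ℝ) ^ n *
      min 1 (Metric.infDist (TopologicalSpace.denseSeq (E k) n) (C : Set (E k))) :=
  Summable.of_norm_bounded half_summ (whit_bd k C)

lemma whit_cont (k : ℕ) : Continuous (whit k) := by
  unfold whit
  refine continuous_tsum (fun n => ?_) half_summ (fun n C => whit_bd k C n)
  exact continuous_const.mul (continuous_const.min (Metric.lipschitz_infDist_set _).continuous)

lemma whit_strict {k : ℕ} {C C' : TopologicalSpace.NonemptyCompacts (E k)}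
    (h : (C : Set (E k)) ⊆ C') (hw : whit k C = whit k C') : C = C' := by
  by_contra hne
  have h2 : ¬ (C' : Set (E k)) ⊆ C := fun h3 => hne (SetLike.coe_injective (h.antisymm h3))
  obtain ⟨y, hy', hy⟩ := Set.not_subset.1 h2
  have hpos : 0 < Metric.infDist y (C : Set (E k)) :=
    (C.isCompact.isClosed.notMem_iff_infDist_pos C.nonempty).1 hy
  set δ := min 1 (Metric.infDist y (C : Set (E k))) with hδ
  have hδ0 : 0 < δ := lt_min one_pos hpos
  obtain ⟨n, hn⟩ : ∃ n, dist y (TopologicalSpace.denseSeq (E k) n) < δ / 2 :=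
    (TopologicalSpace.denseRange_denseSeq (E k)).exists_dist_lt y (by linarith)
  refine absurd hw (ne_of_gt ?_)
  unfold whit
  have hle : ∀ x, Metric.infDist x (C' : Set (E k)) ≤ Metric.infDist x (C : Set (E k)) :=
    fun x => Metric.infDist_le_infDist_of_subset h C.nonempty
  refine Summable.tsum_lt_tsum (i := n) (fun m => ?_) ?_ (whit_summ k C') (whit_summ k C)
  · have := hle (TopologicalSpace.denseSeq (E k) m)
    gcongr
  · have a1 : Metric.infDist (TopologicalSpace.denseSeq (E k) n) (C' : Set (E k)) < δ / 2 := by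
      refine (Metric.infDist_le_dist_of_mem hy').trans_lt ?_
      rwa [dist_comm]
    have a2 := Metric.infDist_le_infDist_add_dist (s := (C : Set (E k))) (x := y)
      (y := TopologicalSpace.denseSeq (E k) n)
    have a3 : δ ≤ Metric.infDist y (C : Set (E k)) := min_le_right _ _
    have a4 : δ ≤ 1 := min_le_left _ _
    have : min 1 (Metric.infDist (TopologicalSpace.denseSeq (E k) n) (C' : Set (E k))) <
        min 1 (Metric.infDist (TopologicalSpace.denseSeq (E k) n) (C : Set (E k))) := by
      refine lt_min ((min_le_right _ _).trans_lt (by linarith))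
        ((min_le_right _ _).trans_lt (by linarith))
    gcongr

/-! ### The main theorem -/

lemma dd_nonempty {k : ℕ} (hk : 3 ≤ k) {β : ℝ} (hβ : (k : ℝ) - 1 ≤ β) : (DD k β).Nonempty := by
  have h3 : (3 : ℝ) ≤ k := by exact_mod_cast hk
  refine Set.Nonempty.mono (dd_mono (by linarith) hβ) ?_
  rw [dd_bot hk]
  refine ⟨evec k 0, ⟨fun i => ?_, ?_⟩, ?_⟩
  · show (0 : ℝ) ≤ if (i : ℕ) = 0 then 1 else 0
    split_ifs <;> norm_num
  · show ∑ i : Fin k, (if (i : ℕ) = 0 then (1 : ℝ) else 0) = 1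
    rw [Finset.sum_eq_single ⟨0, by omega⟩]
    · simp
    · intro i _ hi
      rw [if_neg]
      intro h
      exact hi (Fin.ext h)
    · simp
  · unfold proj
    split_ifs
    · show (if k - 1 = 0 then (1 : ℝ) else 0) = 0
      rw [if_neg (by omega)]
    · rfl

/-- `DF` as a map into the hyperspace. -/
noncomputable def gmap (k : ℕ) (hk : 3 ≤ k) (β : Set.Icc ((k : ℝ) - 1) (k : ℝ)) :
    TopologicalSpace.NonemptyCompacts (E k) where
  carrier := DD k β
  isCompact' := by
    have h3 : (3 : ℝ) ≤ k := by exact_mod_cast hk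
    exact (simplex_compact k).of_isClosed_subset (dd_closed (by linarith [β.2.1])) fun α h => h.1
  nonempty' := dd_nonempty hk β.2.1

lemma gmap_cont (k : ℕ) (hk : 3 ≤ k) : Continuous (gmap k hk) := by
  have h3 : (3 : ℝ) ≤ k := by exact_mod_cast hk
  rw [Metric.continuous_iff]
  intro β ε hε
  obtain ⟨N, hN⟩ := exists_nat_gt (k * 3 / (ε / 2))
  have hNpos : 0 < N := by
    rcases Nat.eq_zero_or_pos N with h | h
    · rw [h] at hN
      have : (0 : ℝ) < k * 3 / (ε / 2) := by positivity
      simp at hN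
      linarith
    · exact h
  have hNr : (0 : ℝ) < N := by exact_mod_cast hNpos
  have hNε : (k : ℝ) * (3 / N) ≤ ε / 2 := by
    rw [div_lt_iff₀ (by linarith)] at hN
    rw [← mul_div_assoc, div_le_iff₀ hNr]
    linarith
  refine ⟨(k : ℝ)⁻¹ ^ (2 * N) / k, by positivity, fun β' hd => ?_⟩
  have hd' : k * |(β' : ℝ) - β| < (k : ℝ)⁻¹ ^ (2 * N) := by
    have : |(β' : ℝ) - β| < (k : ℝ)⁻¹ ^ (2 * N) / k := hd
    rwa [lt_div_iff₀ (by linarith), mul_comm] at this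
  have hb : (2 : ℝ) ≤ β := by linarith [β.2.1]
  have hb' : (2 : ℝ) ≤ β' := by linarith [β'.2.1]
  refine lt_of_le_of_lt ?_ (by linarith : ε / 2 < ε)
  rw [Metric.NonemptyCompacts.dist_eq]
  refine Metric.hausdorffDist_le_of_mem_dist (by linarith) ?_ ?_
  · intro α hα
    obtain ⟨γ, hγ, h⟩ := dd_near hb hb' β'.2.2 hNpos (by rwa [abs_sub_comm]) hα
    exact ⟨γ, hγ, h.trans hNε⟩
  · intro α hα
    obtain ⟨γ, hγ, h⟩ := dd_near hb' hb β.2.2 hNpos hd' hα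
    exact ⟨γ, hγ, h.trans hNε⟩

lemma dfull_eq (k : ℕ) (hk : 3 ≤ k) : Dfull k = Set.range (gmap k hk) := by
  ext C
  constructor
  · rintro ⟨β, hβ, h⟩
    refine ⟨⟨β, hβ⟩, SetLike.coe_injective ?_⟩
    rw [h, dfext_eq hk hβ]
    rfl
  · rintro ⟨β, rfl⟩
    refine ⟨β, β.2, ?_⟩
    rw [dfext_eq hk β.2]
    rfl

lemma face_ne (k : ℕ) (hk : 3 ≤ k) : faceF k ≠ simplex k := by
  intro h
  have h1 : evec k (k - 1) ∈ simplex k := by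
    refine ⟨fun i => ?_, ?_⟩
    · show (0 : ℝ) ≤ if (i : ℕ) = k - 1 then 1 else 0
      split_ifs <;> norm_num
    · show ∑ i : Fin k, (if (i : ℕ) = k - 1 then (1 : ℝ) else 0) = 1
      rw [Finset.sum_eq_single ⟨k - 1, by omega⟩]
      · simp
      · intro i _ hi
        rw [if_neg]
        intro h
        exact hi (Fin.ext h)
      · simp
  rw [← h] at h1
  have h2 := h1.2
  unfold proj at h2
  rw [dif_pos (by omega)] at h2
  have h3 : (if k - 1 = k - 1 then (1 : ℝ) else 0) = 0 := h2
  simp at h3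
/-- `{DF(β) : β ∈ [k−1,k]}` is homeomorphic to a compact interval. -/
theorem stmt15 (k : ℕ) (hk : 3 ≤ k) :
    Nonempty (↥(Dfull k) ≃ₜ ↥(Set.Icc (0 : ℝ) 1)) := by
  have h3 : (3 : ℝ) ≤ k := by exact_mod_cast hk
  have hI : (k : ℝ) - 1 ≤ k := by linarith
  haveI : Fact ((k : ℝ) - 1 ≤ k) := ⟨hI⟩
  haveI : CompactSpace ↥(Dfull k) := by
    rw [← isCompact_iff_compactSpace, dfull_eq k hk]
    exact isCompact_range (gmap_cont k hk)
  let f : ↥(Dfull k) → ℝ := fun C => whit k C.1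
  have hf : Continuous f := (whit_cont k).comp continuous_subtype_val
  have hinj : Function.Injective f := by
    rintro ⟨C, hC⟩ ⟨C', hC'⟩ h
    have h' : whit k C = whit k C' := h
    rw [dfull_eq k hk] at hC hC'
    obtain ⟨β, rfl⟩ := hC
    obtain ⟨β', rfl⟩ := hC'
    apply Subtype.ext
    rcases le_total β β' with hb | hb
    · exact whit_strict (dd_mono (by linarith [β.2.1]) hb) h'
    · exact (whit_strict (dd_mono (by linarith [β'.2.1]) hb) h'.symm).symm
  have hrange : Set.range f = Set.range fun β => whit k (gmap k hk β) := by
    ext x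
    constructor
    · rintro ⟨⟨C, hC⟩, rfl⟩
      rw [dfull_eq k hk] at hC
      obtain ⟨β, rfl⟩ := hC
      exact ⟨β, rfl⟩
    · rintro ⟨β, rfl⟩
      exact ⟨⟨gmap k hk β, by rw [dfull_eq k hk]; exact ⟨β, rfl⟩⟩, rfl⟩
  have hc : Continuous fun β => whit k (gmap k hk β) := (whit_cont k).comp (gmap_cont k hk)
  haveI : PreconnectedSpace ↥(Set.Icc ((k : ℝ) - 1) (k : ℝ)) :=
    isPreconnected_iff_preconnectedSpace.1 isPreconnected_Icc
  haveI : ConnectedSpace ↥(Set.Icc ((k : ℝ) - 1) (k : ℝ)) :=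
    { toNonempty := ⟨⟨k, hI, le_rfl⟩⟩ }
  have hconn : IsConnected (Set.range f) := by
    rw [hrange]
    exact isConnected_range hc
  have hcomp : IsCompact (Set.range f) := isCompact_range hf
  have hIcc := eq_Icc_of_connected_compact hconn hcomp
  set a := sInf (Set.range f)
  set b := sSup (Set.range f)
  have hab : a < b := by
    by_contra hle
    have hsub : (Set.Icc a b).Subsingleton := Set.subsingleton_Icc_of_ge (not_lt.1 hle)
    rw [← hIcc] at hsub
    have m1 : gmap k hk ⟨(k : ℝ) - 1, le_rfl, hI⟩ ∈ Dfull k := by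
      rw [dfull_eq k hk]; exact ⟨_, rfl⟩
    have m2 : gmap k hk ⟨(k : ℝ), hI, le_rfl⟩ ∈ Dfull k := by
      rw [dfull_eq k hk]; exact ⟨_, rfl⟩
    have h1 := hinj (hsub ⟨⟨_, m1⟩, rfl⟩ ⟨⟨_, m2⟩, rfl⟩)
    have h2 : DD k ((k : ℝ) - 1) = DD k (k : ℝ) :=
      congrArg (fun C : ↥(Dfull k) => ((C.1 : TopologicalSpace.NonemptyCompacts (E k)) : Set (E k))) h1
    rw [dd_bot hk, dd_top hk] at h2
    exact face_ne k hk h2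
  have hcont : Continuous (Equiv.ofInjective f hinj) := hf.subtype_mk _
  exact ⟨(hcont.homeoOfEquivCompactToT2.trans (Homeomorph.setCongr hIcc)).trans (iccHomeoI a b hab)⟩

end BetaDF
end

section
/- Let k ≥ 3 be an integer. For Lebesgue-almost every β ∈ (k−1, k), the digit frequency set DF(β) is the convex hull of a finite subset of Δ ∩ ℚ^k (a polytope with rational vertices). -/
open Filter Topology
open scoped Classical

namespace BetaDF

/-! ### Windows and subshifts of finite type -/

/-- Strict lexicographic order on windows of length `L`. -/
def wlt (L : ℕ) (u w : ℕ → ℕ) : Prop := ∃ j, j < L ∧ (∀ s, s < j → u s ≤ w s) ∧ u j < w j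

/-- Sequences all of whose `L`-windows are strictly below `w`. -/
def XL (L : ℕ) (w : Seq) : Set Seq := {v | ∀ r, wlt L (fun s => v (r + s)) w}

lemma wlt_congr {L : ℕ} {u u' w : ℕ → ℕ} (h : ∀ s, s < L → u s = u' s) (hu : wlt L u w) :
    wlt L u' w := by
  obtain ⟨j, hj, h1, h2⟩ := hu
  refine ⟨j, hj, fun s hs => ?_, ?_⟩
  · rw [← h s (by omega)]; exact h1 s hs
  · rw [← h j hj]; exact h2

lemma XL_lt {L : ℕ} {w v : Seq} {k : ℕ} (hw : w 0 < k) (hv : v ∈ XL L w) (r : ℕ) : v r < k := by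
  obtain ⟨j, hj, h1, h2⟩ := hv r
  rcases Nat.eq_zero_or_pos j with h0 | h0
  · subst h0
    simp only [add_zero] at h2
    omega
  · have := h1 0 h0
    simp only [add_zero] at this
    omega

lemma digitCount_eq_sum (w : Seq) (i r : ℕ) :
    (digitCount w i r : ℝ) = ∑ s ∈ Finset.range r, if w s = i then (1 : ℝ) else 0 := by
  unfold digitCount
  rw [Finset.card_filter]
  push_cast
  rfl

/-- Cutting out a loop. -/
lemma XL_cut {L : ℕ} {w v : Seq} (hv : v ∈ XL L w) (i p : ℕ)
    (h : ∀ t, t < L → v (i + t) = v (i + p + t)) :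
    (fun n => if n < i then v n else v (n + p)) ∈ XL L w := by
  intro r
  by_cases hr : r < i
  · refine wlt_congr ?_ (hv r)
    intro s hs
    by_cases h1 : r + s < i
    · simp [h1]
    · simp only [h1, if_false]
      have := h (r + s - i) (by omega)
      rw [show i + (r + s - i) = r + s by omega,
        show i + p + (r + s - i) = r + s + p by omega] at this
      exact this
  · refine wlt_congr ?_ (hv (r + p))
    intro s hs
    have : ¬ (r + s < i) := by omega
    simp only [this, if_false]
    congr 1; omega

lemma XL_per {L : ℕ} {w v : Seq} (hv : v ∈ XL L w) (i p : ℕ) (hp : 0 < p)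
    (h : ∀ t, t < L → v (i + t) = v (i + p + t)) :
    (fun n => v (i + n % p)) ∈ XL L w := by
  have key : ∀ s, s < p + L → v (i + s) = v (i + s % p) := by
    intro s
    induction s using Nat.strong_induction_on with
    | _ s ih =>
      intro hs
      by_cases h1 : s < p
      · rw [Nat.mod_eq_of_lt h1]
      · have h2 := ih (s - p) (by omega) (by omega)
        have h3 := h (s - p) (by omega)
        rw [show i + p + (s - p) = i + s by omega] at h3
        rw [← h3, h2]
        rw [Nat.mod_eq_sub_mod (by omega : s ≥ p)]
  intro r
  refine wlt_congr ?_ (hv (i + r % p))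
  intro s hs
  have := Nat.mod_lt r hp
  have h1 := key (r % p + s) (by omega)
  simp only
  rw [add_assoc, h1]
  congr 2
  exact Nat.mod_add_mod r p s

lemma XL_bound {L : ℕ} {w : Seq} {k : ℕ} (hw : w 0 < k) (a : ℕ → ℝ) (μ C : ℝ)
    (hC : ∀ i, i < k → a i ≤ μ + C) (hC0 : 0 ≤ C)
    (hcyc : ∀ c ∈ XL L w, ∀ p, 0 < p → p ≤ k ^ L → (∀ n, c (n % p) = c n) →
      ∑ s ∈ Finset.range p, a (c s) ≤ p * μ) :
    ∀ n, ∀ v ∈ XL L w, ∑ s ∈ Finset.range n, a (v s) ≤ n * μ + (k ^ L : ℕ) * C := by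
  intro n
  induction n using Nat.strong_induction_on with
  | _ n ih =>
    intro v hv
    by_cases hn : n ≤ k ^ L
    · have h1 : ∑ s ∈ Finset.range n, a (v s) ≤ ∑ s ∈ Finset.range n, (μ + C) :=
        Finset.sum_le_sum fun s _ => hC _ (XL_lt hw hv s)
      simp only [Finset.sum_const, Finset.card_range, nsmul_eq_mul] at h1
      have h2 : (n : ℝ) * C ≤ (k ^ L : ℕ) * C :=
        mul_le_mul_of_nonneg_right (by exact_mod_cast hn) hC0
      linarith
    · push Not at hn
      have hcard : Fintype.card (Fin L → Fin k) < Fintype.card (Fin (k ^ L + 1)) := by simp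
      obtain ⟨x, y, hxy, hf⟩ := Fintype.exists_ne_map_eq_of_card_lt
        (fun (x : Fin (k ^ L + 1)) => (fun t : Fin L => (⟨v (x + t), XL_lt hw hv _⟩ : Fin k))) hcard
      have main : ∃ i j : ℕ, i < j ∧ j ≤ k ^ L ∧ ∀ t, t < L → v (i + t) = v (j + t) := by
        have hf' : ∀ t, t < L → v (x + t) = v (y + t) := by
          intro t ht
          have := congrFun hf ⟨t, ht⟩
          simpa using this
        rcases lt_or_gt_of_ne hxy with h | h
        · exact ⟨x, y, h, by omega, hf'⟩
        · exact ⟨y, x, h, by omega, fun t ht => (hf' t ht).symm⟩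
      obtain ⟨i, j, hij, hj, heq⟩ := main
      obtain ⟨p, rfl⟩ : ∃ p, j = i + p := ⟨j - i, by omega⟩
      have hp : 0 < p := by omega
      have hc := XL_cut hv i p heq
      have hq := XL_per hv i p hp heq
      have h1 := ih (n - p) (by omega) _ hc
      have h2 := hcyc _ hq p hp (by omega) (fun n => by simp)
      have h3 : ∑ s ∈ Finset.range n, a (v s) =
          ∑ s ∈ Finset.range (n - p), a (if s < i then v s else v (s + p)) +
          ∑ s ∈ Finset.range p, a (v (i + s % p)) := by
        obtain ⟨q, rfl⟩ : ∃ q, n = i + p + q := ⟨n - (i + p), by omega⟩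
        rw [show i + p + q - p = i + q by omega, Finset.sum_range_add _ (i + p) q,
          Finset.sum_range_add _ i p, Finset.sum_range_add _ i q]
        have e1 : ∑ s ∈ Finset.range i, a (if s < i then v s else v (s + p)) =
            ∑ s ∈ Finset.range i, a (v s) :=
          Finset.sum_congr rfl fun s hs => by rw [if_pos (Finset.mem_range.1 hs)]
        have e2 : ∑ s ∈ Finset.range q, a (if i + s < i then v (i + s) else v (i + s + p)) =
            ∑ s ∈ Finset.range q, a (v (i + p + s)) :=
          Finset.sum_congr rfl fun s hs => by
            rw [if_neg (by omega)]; congr 2; omega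
        have e3 : ∑ s ∈ Finset.range p, a (v (i + s % p)) = ∑ s ∈ Finset.range p, a (v (i + s)) :=
          Finset.sum_congr rfl fun s hs => by rw [Nat.mod_eq_of_lt (Finset.mem_range.1 hs)]
        rw [e1, e2, e3]; ring
      rw [h3]
      have h4 : ((n - p : ℕ) : ℝ) = n - p := by
        rw [Nat.cast_sub (by omega)]
      rw [h4] at h1
      linarith

/-- The finite set of frequency vectors of short cycles. -/
def Vset (k L : ℕ) (w : Seq) : Set (E k) :=
  {α | ∃ c ∈ XL L w, ∃ p, 0 < p ∧ p ≤ k ^ L ∧ (∀ n, c (n % p) = c n) ∧ α = freqVec k c p}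

lemma digitCount_le (w : Seq) (i r : ℕ) : digitCount w i r ≤ r := by
  unfold digitCount
  exact (Finset.card_filter_le _ _).trans (by simp)

lemma Vset_finite (k L : ℕ) (w : Seq) : (Vset k L w).Finite := by
  refine (Set.finite_range (fun x : Fin (k ^ L + 1) × (Fin k → Fin (k ^ L + 1)) =>
    ((WithLp.equiv 2 (Fin k → ℝ)).symm fun i => ((x.2 i : ℕ) : ℝ) / ((x.1 : ℕ) : ℝ) : E k))).subset ?_
  rintro α ⟨c, hc, p, hp, hpM, hper, rfl⟩
  refine ⟨(⟨p, by omega⟩, fun i => ⟨digitCount c i p, ?_⟩), rfl⟩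
  have := digitCount_le c i p
  omega

lemma lin_expand {k : ℕ} (f : E k →L[ℝ] ℝ) (x : E k) :
    f x = ∑ i, x i * f (EuclideanSpace.single i 1) := by
  have : x = ∑ i, x i • EuclideanSpace.single i (1 : ℝ) := by
    ext j
    simp [Pi.single_apply]
  conv_lhs => rw [this]
  simp [map_sum]

lemma sum_digits {k : ℕ} (b : Fin k → ℝ) (v : Seq) (hv : ∀ r, v r < k) (n : ℕ) :
    ∑ s ∈ Finset.range n, (if h : v s < k then b ⟨v s, h⟩ else 0) =
      ∑ i : Fin k, (digitCount v i n : ℝ) * b i := by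
  simp_rw [digitCount_eq_sum, Finset.sum_mul]
  rw [Finset.sum_comm]
  refine Finset.sum_congr rfl fun s _ => ?_
  rw [dif_pos (hv s)]
  rw [Finset.sum_eq_single (⟨v s, hv s⟩ : Fin k)]
  · simp
  · intro i _ hi
    rw [if_neg, zero_mul]
    intro h
    exact hi (Fin.ext h.symm)
  · simp

lemma freq_mem_hull {k L : ℕ} {w : Seq} (hw : w 0 < k) {v : Seq} (hv : v ∈ XL L w) {α : E k}
    (hα : HasDigitFreq k v α) : α ∈ convexHull ℝ (Vset k L w) := by
  by_contra hcon
  obtain ⟨f, u, h1, h2⟩ := geometric_hahn_banach_closed_point (convex_convexHull ℝ _)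
    ((Vset_finite k L w).isClosed_convexHull ℝ) hcon
  set b : Fin k → ℝ := fun i => f (EuclideanSpace.single i 1) with hb
  set a : ℕ → ℝ := fun i => if h : i < k then b ⟨i, h⟩ else 0 with ha
  have hbound := XL_bound (L := L) hw a u (∑ i, |b i - u|) ?_ (by positivity) ?_
  · -- limit
    have hlim : Tendsto (fun n : ℕ => (∑ s ∈ Finset.range n, a (v s)) / n) atTop (𝓝 (f α)) := by
      have e : ∀ n : ℕ, (∑ s ∈ Finset.range n, a (v s)) / n =
          ∑ i : Fin k, (digitCount v i n : ℝ) / n * b i := by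
        intro n
        rw [sum_digits b v (XL_lt hw hv), Finset.sum_div]
        exact Finset.sum_congr rfl fun i _ => by ring
      simp_rw [e]
      rw [lin_expand f α]
      refine tendsto_finsetSum _ fun i _ => ?_
      have := hα i i.2
      simp only [proj, i.2, dif_pos] at this
      exact this.mul_const _
    have hlim2 : Tendsto (fun n : ℕ => u + ((k ^ L : ℕ) * ∑ i, |b i - u|) / (n : ℝ)) atTop
        (𝓝 (u + 0)) :=
      tendsto_const_nhds.add (tendsto_const_div_atTop_nhds_zero_nat _)
    have : f α ≤ u + 0 := by
      refine le_of_tendsto_of_tendsto hlim hlim2 ?_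
      filter_upwards [eventually_gt_atTop 0] with n hn
      have hn' : (0 : ℝ) < n := by exact_mod_cast hn
      rw [div_le_iff₀ hn', add_mul, div_mul_cancel₀ _ hn'.ne']
      have := hbound n v hv
      linarith
    linarith
  · intro i hi
    simp only [ha, hi, dif_pos]
    have h3 : |b ⟨i, hi⟩ - u| ≤ ∑ i, |b i - u| :=
      Finset.single_le_sum (f := fun i => |b i - u|) (fun i _ => abs_nonneg _) (Finset.mem_univ _)
    have := le_abs_self (b ⟨i, hi⟩ - u)
    linarith
  · intro c hc p hp hpM hper
    have h3 := h1 _ (subset_convexHull ℝ _ ⟨c, hc, p, hp, hpM, hper, rfl⟩)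
    have hp' : (0 : ℝ) < p := by exact_mod_cast hp
    rw [lin_expand] at h3
    rw [sum_digits b c (XL_lt hw hc)]
    have e : ∑ i : Fin k, (digitCount c i p : ℝ) * b i =
        p * ∑ i, (freqVec k c p) i * f (EuclideanSpace.single i 1) := by
      rw [Finset.mul_sum]
      refine Finset.sum_congr rfl fun i _ => ?_
      simp only [freqVec, WithLp.equiv_symm_apply, hb]
      field_simp
    rw [e]
    exact (mul_le_mul_of_nonneg_left h3.le hp'.le)

lemma Vset_rat {k L : ℕ} {w : Seq} (hw : w 0 < k) {α : E k} (hα : α ∈ Vset k L w) :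
    α ∈ simplex k ∧ ∀ i : Fin k, ∃ q : ℚ, α i = (q : ℝ) := by
  obtain ⟨c, hc, p, hp, hpM, hper, rfl⟩ := hα
  have hp' : (0 : ℝ) < p := by exact_mod_cast hp
  refine ⟨⟨fun i => ?_, ?_⟩, fun i => ⟨(digitCount c i p : ℚ) / p, ?_⟩⟩
  · simp only [freqVec, WithLp.equiv_symm_apply]; positivity
  · simp only [freqVec, WithLp.equiv_symm_apply]
    rw [← Finset.sum_div]
    have := sum_digits (fun _ : Fin k => (1 : ℝ)) c (XL_lt hw hc) p
    simp only [mul_one] at this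
    rw [← this]
    have e : ∀ s, (if h : c s < k then (1 : ℝ) else 0) = 1 := fun s => by
      rw [dif_pos (XL_lt hw hc s)]
    simp only [e]
    simp [hp'.ne']
  · simp [freqVec, WithLp.equiv_symm_apply]


/-! ### Left-porous sets are null -/

lemma porous_null (B : Set ℝ) (c : ℝ) (hc : 0 < c) (hc1 : c ≤ 1)
    (h : ∀ x ∈ B, ∀ ε > 0, ∃ l, l < x ∧ x - l < ε ∧ ∀ y, l < y → y < l + c * (x - l) → y ∉ B) :
    MeasureTheory.volume B = 0 := by
  have key := IsUnifLocDoublingMeasure.ae_tendsto_measure_inter_div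
    (MeasureTheory.volume : MeasureTheory.Measure ℝ) B 1
  rw [MeasureTheory.ae_iff] at key
  refine le_antisymm (le_trans (le_trans (MeasureTheory.measure_mono ?_)
    (MeasureTheory.Measure.le_restrict_apply B _)) (le_of_eq key)) zero_le
  intro x hx
  refine ⟨?_, hx⟩
  intro hcon
  have hch : ∀ n : ℕ, ∃ l, l < x ∧ x - l < 1 / ((n : ℝ) + 1) ∧
      ∀ y, l < y → y < l + c * (x - l) → y ∉ B :=
    fun n => h x hx _ (by positivity)
  choose l hl1 hl2 hl3 using hch
  have hδ : Tendsto (fun n => (x - l n) / 2) atTop (𝓝[>] 0) := by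
    refine tendsto_nhdsWithin_iff.2 ⟨?_, Eventually.of_forall fun n => ?_⟩
    · refine squeeze_zero (fun n => ?_) (fun n => ?_) (tendsto_one_div_add_atTop_nhds_zero_nat (𝕜 := ℝ))
      · have := hl1 n; linarith
      · have := hl1 n; have := hl2 n; linarith
    · have := hl1 n
      simp only [Set.mem_Ioi]; linarith
  have ht := hcon (fun n => (l n + x) / 2) (fun n => (x - l n) / 2) hδ
    (Eventually.of_forall fun n => by
      have := hl1 n
      rw [Metric.mem_closedBall, Real.dist_eq, abs_le]
      constructor <;> linarith)
  have hle : (1 : ENNReal) ≤ ENNReal.ofReal (1 - c) := by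
    refine le_of_tendsto ht (Eventually.of_forall fun n => ?_)
    have hp : 0 < x - l n := by have := hl1 n; linarith
    rw [Real.volume_closedBall]
    have hsub : B ∩ Metric.closedBall ((l n + x) / 2) ((x - l n) / 2) ⊆
        {l n} ∪ Set.Icc (l n + c * (x - l n)) x := by
      rintro y ⟨hy, hy2⟩
      rw [Real.closedBall_eq_Icc] at hy2
      obtain ⟨a1, a2⟩ := hy2
      have a1' : l n ≤ y := by linarith
      have a2' : y ≤ x := by linarith
      rcases eq_or_lt_of_le a1' with h0 | h0
      · left; exact h0.symm
      · right
        refine ⟨?_, a2'⟩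
        by_contra hh
        exact hl3 n y h0 (not_le.1 hh) hy
    have hm : MeasureTheory.volume (B ∩ Metric.closedBall ((l n + x) / 2) ((x - l n) / 2)) ≤
        ENNReal.ofReal ((1 - c) * (x - l n)) := by
      refine (MeasureTheory.measure_mono hsub).trans ((MeasureTheory.measure_union_le _ _).trans ?_)
      rw [Real.volume_singleton, zero_add, Real.volume_Icc]
      apply ENNReal.ofReal_le_ofReal
      linarith
    refine ENNReal.div_le_of_le_mul (hm.trans ?_)
    rw [ENNReal.ofReal_mul (by linarith)]
    apply le_of_eq
    congr 2
    ring
  have : ENNReal.ofReal (1 - c) < 1 := by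
    rw [← ENNReal.ofReal_one]
    exact (ENNReal.ofReal_lt_ofReal_iff one_pos).2 (by linarith)
  exact absurd hle (not_le.2 this)

/-! ### Parameter cylinders -/

/-- `G p m x`: the polynomial giving the `m`-th iterate of `1` along digits `p`. -/
def G (p : ℕ → ℕ) : ℕ → ℝ → ℝ
  | 0, _ => 1
  | m + 1, x => x * G p m x - p m

lemma G_succ (p : ℕ → ℕ) (m : ℕ) (x : ℝ) : G p (m + 1) x = x * G p m x - p m := rfl

lemma convexOn_sub_const' {s : Set ℝ} {f : ℝ → ℝ} (hf : ConvexOn ℝ s f) (c : ℝ) :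
    ConvexOn ℝ s (fun x => f x - c) := by
  have := hf.add (convexOn_const (-c) hf.1)
  refine this.congr fun x _ => ?_
  simp [sub_eq_add_neg]

lemma G_cont (p : ℕ → ℕ) (m : ℕ) : Continuous (G p m) := by
  induction m with
  | zero => exact continuous_const
  | succ m ih => exact (continuous_id.mul ih).sub continuous_const

lemma fbeta_iter_mem {β : ℝ} (s : ℕ) :
    0 ≤ (fbeta β)^[s] 1 ∧ (fbeta β)^[s] 1 ≤ 1 ∧ (0 < s → (fbeta β)^[s] 1 < 1) := by
  cases s with
  | zero => simp
  | succ s =>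
    rw [Function.iterate_succ_apply']
    unfold fbeta
    exact ⟨Int.fract_nonneg _, (Int.fract_lt_one _).le, fun _ => Int.fract_lt_one _⟩

lemma G_iter {β : ℝ} (hβ : 0 < β) (m : ℕ) : G (dbeta β 1) m β = (fbeta β)^[m] 1 := by
  induction m with
  | zero => simp [G]
  | succ m ih =>
    rw [Function.iterate_succ_apply', G, ih]
    have h0 : 0 ≤ β * (fbeta β)^[m] 1 := mul_nonneg hβ.le (fbeta_iter_mem m).1
    conv_rhs => rw [fbeta]
    rw [dbeta, ← Int.self_sub_floor]
    congr 1
    exact natCast_floor_eq_intCast_floor h0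

/-- If the polynomials stay in `[0,1)` then they compute the orbit and digits. -/
lemma digits_of_G {x : ℝ} (p : ℕ → ℕ) (m : ℕ)
    (h : ∀ s, 0 < s → s ≤ m → 0 ≤ G p s x ∧ G p s x < 1) :
    (∀ s, s ≤ m → (fbeta x)^[s] 1 = G p s x) ∧ ∀ s, s < m → dbeta x 1 s = p s := by
  have hd : ∀ s, s < m → (fbeta x)^[s] 1 = G p s x →
      (fbeta x)^[s+1] 1 = G p (s+1) x ∧ dbeta x 1 s = p s := by
    intro s hs e
    obtain ⟨h1, h2⟩ := h (s + 1) (by omega) (by omega)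
    have e2 : x * G p s x = p s + G p (s + 1) x := by rw [G]; ring
    constructor
    · rw [Function.iterate_succ_apply', e, fbeta, e2, add_comm, Int.fract_add_natCast,
        Int.fract_eq_self.2 ⟨h1, h2⟩]
    · rw [dbeta, e, e2, add_comm, Nat.floor_add_natCast h1, Nat.floor_eq_zero.2 h2, zero_add]
  have hi : ∀ s, s ≤ m → (fbeta x)^[s] 1 = G p s x := by
    intro s
    induction s with
    | zero => intro _; simp [G]
    | succ s ih => intro hs; exact (hd s (by omega) (ih (by omega))).1
  exact ⟨hi, fun s hs => (hd s hs (hi s hs.le)).2⟩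

lemma dbeta_zero {k : ℕ} (hk : 3 ≤ k) {β : ℝ} (h1 : (k : ℝ) - 1 < β) (h2 : β < k) :
    dbeta β 1 0 = k - 1 := by
  unfold dbeta
  simp only [Function.iterate_zero, id_eq, mul_one]
  rw [Nat.floor_eq_iff (by have : (3:ℝ) ≤ k := by exact_mod_cast hk
                           linarith)]
  rw [Nat.cast_sub (by omega)]
  constructor <;> push_cast <;> linarith

/-- The left part of the parameter cylinder of level `m`. -/
lemma cyl {k : ℕ} (hk : 3 ≤ k) {β : ℝ} (h1 : (k : ℝ) - 1 < β) (h2 : β < k) (m : ℕ) :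
    ∃ l, (k : ℝ) - 1 ≤ l ∧ l ≤ β ∧ G (dbeta β 1) (m + 1) l = 0 ∧
      (∀ s, 0 < s → s ≤ m + 1 → ∀ x ∈ Set.Icc l β,
        0 ≤ G (dbeta β 1) s x ∧ G (dbeta β 1) s x < 1) ∧
      (∀ x ∈ Set.Icc l β, ∀ y ∈ Set.Icc l β, x ≤ y →
        2 ^ m * (y - x) ≤ G (dbeta β 1) (m + 1) y - G (dbeta β 1) (m + 1) x) ∧
      ConvexOn ℝ (Set.Icc l β) (G (dbeta β 1) (m + 1)) := by
  have hk' : (3 : ℝ) ≤ k := by exact_mod_cast hk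
  have hβ : 0 < β := by linarith
  set p := dbeta β 1 with hp
  have hGβ : ∀ s, 0 < s → 0 ≤ G p s β ∧ G p s β < 1 := by
    intro s hs
    rw [hp, G_iter hβ]
    exact ⟨(fbeta_iter_mem s).1, (fbeta_iter_mem s).2.2 hs⟩
  induction m with
  | zero =>
    have e : ∀ x, G p 1 x = x - ((k : ℝ) - 1) := by
      intro x
      simp only [G]
      rw [hp, dbeta_zero hk h1 h2, Nat.cast_sub (by omega)]
      push_cast; ring
    refine ⟨(k : ℝ) - 1, le_rfl, h1.le, ?_, ?_, ?_, ?_⟩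
    · rw [zero_add, e]; ring
    · intro s hs hs1 x hx
      obtain rfl : s = 1 := by omega
      rw [e]
      exact ⟨by linarith [hx.1], by linarith [hx.2]⟩
    · intro x _ y _ _
      rw [zero_add, e, e]; simp
    · have : G p (0 + 1) = fun x => x - ((k : ℝ) - 1) := funext e
      rw [this]
      exact convexOn_sub_const' (convexOn_id (convex_Icc _ _)) _
  | succ m ih =>
    obtain ⟨l, hl1, hl2, hl0, hlr, hle, hlc⟩ := ih
    have hex : (0 : ℝ) ∈ Set.Icc (G p (m + 2) l) (G p (m + 2) β) := by
      refine ⟨?_, (hGβ (m + 2) (by omega)).1⟩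
      rw [G, hl0]; simp
    obtain ⟨l', ⟨hl'1, hl'2⟩, hl'0⟩ := intermediate_value_Icc hl2 (G_cont p (m + 2)).continuousOn hex
    have hsub : Set.Icc l' β ⊆ Set.Icc l β := Set.Icc_subset_Icc_left hl'1
    have hexp : ∀ x ∈ Set.Icc l β, ∀ y ∈ Set.Icc l β, x ≤ y →
        2 ^ (m + 1) * (y - x) ≤ G p (m + 2) y - G p (m + 2) x := by
      intro x hx y hy hxy
      have a1 := hle x hx y hy hxy
      have a2 := (hlr (m + 1) (by omega) le_rfl x hx).1
      have a3 : 2 ≤ y := by linarith [hy.1]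
      have a4 : 0 ≤ (2:ℝ) ^ m * (y - x) := mul_nonneg (by positivity) (by linarith)
      have e : G p (m + 2) y - G p (m + 2) x =
          y * (G p (m + 1) y - G p (m + 1) x) + (y - x) * G p (m + 1) x := by
        rw [G_succ p (m + 1), G_succ p (m + 1)]; ring
      rw [e, pow_succ]
      nlinarith [mul_nonneg (sub_nonneg.2 hxy) a2]
    refine ⟨l', hl1.trans hl'1, hl'2, hl'0, ?_, ?_, ?_⟩
    · intro s hs hs1 x hx
      by_cases h : s ≤ m + 1
      · exact hlr s hs h x (hsub hx)
      · obtain rfl : s = m + 2 := by omega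
        have a1 := hexp l' ⟨hl'1, hl'2⟩ x (hsub hx) hx.1
        have a2 := hexp x (hsub hx) β ⟨hl2, le_rfl⟩ hx.2
        have a3 : 0 ≤ (2:ℝ) ^ (m+1) * (x - l') := mul_nonneg (by positivity) (by linarith [hx.1])
        have a4 : 0 ≤ (2:ℝ) ^ (m+1) * (β - x) := mul_nonneg (by positivity) (by linarith [hx.2])
        have a5 := (hGβ (m + 2) (by omega)).2
        constructor <;> linarith
    · intro x hx y hy hxy
      exact hexp x (hsub hx) y (hsub hy) hxy
    · have hconv : ConvexOn ℝ (Set.Icc l' β) ((fun x : ℝ => x) * G p (m + 1)) := by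
        refine ConvexOn.mul (convexOn_id (convex_Icc _ _)) (hlc.subset hsub (convex_Icc _ _)) ?_ ?_ ?_
        · intro x hx; linarith [hx.1]
        · intro x hx; exact (hlr (m + 1) (by omega) le_rfl x (hsub hx)).1
        · have hm : MonotoneOn (G p (m + 1)) (Set.Icc l' β) := by
            intro x hx y hy hxy
            have a1 := hle x (hsub hx) y (hsub hy) hxy
            have a4 : 0 ≤ (2:ℝ) ^ m * (y - x) := mul_nonneg (by positivity) (by linarith)
            linarith
          exact (monotoneOn_id).monovaryOn hm
      have : G p (m + 2) = fun x => ((fun x : ℝ => x) * G p (m + 1) : ℝ → ℝ) x - p (m + 1) := by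
        funext x; simp [G]
      rw [show m + 1 + 1 = m + 2 from rfl, this]
      exact convexOn_sub_const' hconv _

/-- Extending a cylinder by zeros. -/
lemma cyl_zeros {k : ℕ} (hk : 3 ≤ k) {β : ℝ} (h1 : (k : ℝ) - 1 < β) (h2 : β < k)
    (hne : ∀ s, (fbeta β)^[s] 1 ≠ 0) (m N : ℕ) :
    ∃ l, l < β ∧ β - l ≤ (1 / 2) ^ m ∧ ∀ y, l < y → y < l + (1 / (k : ℝ)) ^ N * (β - l) →
      (∀ s, s < m + 1 → dbeta y 1 s = dbeta β 1 s) ∧ ∀ t, t < N → dbeta y 1 (m + 1 + t) = 0 := by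
  obtain ⟨l, hl1, hl2, hl0, hlr, hle, hlc⟩ := cyl hk h1 h2 m
  have hk' : (3 : ℝ) ≤ k := by exact_mod_cast hk
  have hβ : 0 < β := by linarith
  set p := dbeta β 1 with hp
  have hlβ : l < β := by
    refine lt_of_le_of_ne hl2 ?_
    rintro rfl
    apply hne (m + 1)
    rw [← G_iter hβ]; exact hl0
  have hβI : β ∈ Set.Icc l β := ⟨hl2, le_rfl⟩
  have hlI : l ∈ Set.Icc l β := ⟨le_rfl, hl2⟩
  have hG1 := (hlr (m + 1) (by omega) le_rfl β hβI)
  refine ⟨l, hlβ, ?_, ?_⟩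
  · have := hle l hlI β hβI hl2
    rw [hl0] at this
    rw [one_div, inv_pow, ← one_div, le_div_iff₀ (by positivity)]
    linarith
  · intro y hy1 hy2
    set c := (1 / (k : ℝ)) ^ N with hc
    have hc0 : 0 < c := by positivity
    have hc1 : c ≤ 1 := pow_le_one₀ (by positivity) (by rw [div_le_one (by linarith)]; linarith)
    have hd : 0 < β - l := by linarith
    set t := (y - l) / (β - l) with ht
    have ht0 : 0 < t := div_pos (by linarith) hd
    have htc : t < c := by rw [ht, div_lt_iff₀ hd]; linarith
    have hyt : y = (1 - t) * l + t * β := by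
      have : t * (β - l) = y - l := div_mul_cancel₀ _ hd.ne'
      linarith
    have hyβ : y ≤ β := by nlinarith
    have hyI : y ∈ Set.Icc l β := ⟨hy1.le, hyβ⟩
    have hGy : G p (m + 1) y < c := by
      have := hlc.2 hlI hβI (by linarith : 0 ≤ 1 - t) ht0.le (by ring)
      simp only [smul_eq_mul] at this
      rw [← hyt, hl0] at this
      nlinarith [hG1.1, hG1.2]
    obtain ⟨hi, hdg⟩ := digits_of_G p (m + 1) (fun s hs hs1 => hlr s hs hs1 y hyI)
    refine ⟨hdg, ?_⟩
    have hy0 : 0 < y := by linarith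
    have hyk : y < k := by linarith
    have hkp : (0:ℝ) < k := by linarith
    have hG0 := (hlr (m + 1) (by omega) le_rfl y hyI).1
    have hpow : ∀ j, j ≤ N → y ^ j * G p (m + 1) y < 1 := by
      intro j hj
      calc y ^ j * G p (m + 1) y ≤ (k:ℝ) ^ j * G p (m + 1) y := by gcongr
        _ < (k:ℝ) ^ j * c := by gcongr
        _ ≤ (k:ℝ) ^ N * c := by gcongr; linarith
        _ = 1 := by rw [hc, ← mul_pow, mul_one_div_cancel hkp.ne', one_pow]
    have hit : ∀ j, j ≤ N → (fbeta y)^[m + 1 + j] 1 = y ^ j * G p (m + 1) y := by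
      intro j
      induction j with
      | zero => intro _; rw [add_zero, hi _ le_rfl]; simp
      | succ j ih =>
        intro hj
        rw [← add_assoc, Function.iterate_succ_apply', ih (by omega), fbeta, ← mul_assoc, ← pow_succ']
        exact Int.fract_eq_self.2 ⟨by positivity, hpow _ hj⟩
    intro j hj
    rw [dbeta, hit j (by omega), ← mul_assoc, ← pow_succ']
    exact Nat.floor_eq_zero.2 (hpow _ hj)

lemma pow_half_lt (ε : ℝ) (hε : 0 < ε) : ∃ n : ℕ, ∀ m, n ≤ m → (1 / 2 : ℝ) ^ m < ε := by
  obtain ⟨n, hn⟩ := exists_pow_lt_of_lt_one hε (by norm_num : (1 / 2 : ℝ) < 1)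
  exact ⟨n, fun m hm => lt_of_le_of_lt (pow_le_pow_of_le_one (by norm_num) (by norm_num) hm) hn⟩

/-- Existence of a record-breaking run of zeros. -/
def Rec (w : Seq) : Prop := ∃ m N q, 0 < q ∧ q < m ∧ w q ≠ 0 ∧ (∀ s, 0 < s → s < q → w s = 0) ∧
  w (m - 1) ≠ 0 ∧ (∀ t, t < N → w (m + t) = 0) ∧
  ∀ b, b + (N - 1) ≤ m → ∃ t, t < N - 1 ∧ w (b + t) ≠ 0

/-- Parameters whose orbit of `1` never hits zero. -/
def Trans (k : ℕ) : Set ℝ := {β | (k : ℝ) - 1 < β ∧ β < k ∧ ∀ s, (fbeta β)^[s] 1 ≠ 0}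

lemma not_trans_null (k : ℕ) (hk : 3 ≤ k) :
    MeasureTheory.volume {β ∈ Set.Ioo ((k : ℝ) - 1) (k : ℝ) | β ∉ Trans k} = 0 := by
  have hk' : (3 : ℝ) ≤ k := by exact_mod_cast hk
  refine Set.Countable.measure_zero ((Algebraic.countable ℤ ℝ).mono ?_) _
  rintro β ⟨⟨h1, h2⟩, h3⟩
  have : ∃ s, (fbeta β)^[s] 1 = 0 := by
    by_contra hcon
    push Not at hcon
    exact h3 ⟨h1, h2, hcon⟩
  obtain ⟨s, hs⟩ := this
  rw [← G_iter (by linarith)] at hs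
  have hpoly : ∀ p : ℕ → ℕ, ∀ m, ∃ P : Polynomial ℤ, P.Monic ∧ P.natDegree = m ∧
      ∀ x : ℝ, Polynomial.aeval x P = G p m x := by
    intro p m
    induction m with
    | zero => exact ⟨1, Polynomial.monic_one, by simp, fun x => by simp [G]⟩
    | succ m ih =>
      obtain ⟨P, hP1, hP2, hP3⟩ := ih
      have hm : (Polynomial.X * P).Monic := Polynomial.monic_X.mul hP1
      have hdeg : (Polynomial.X * P).natDegree = m + 1 := by
        rw [Polynomial.monic_X.natDegree_mul hP1, Polynomial.natDegree_X, hP2, add_comm]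
      have hlt : (Polynomial.C (p m : ℤ)).degree < (Polynomial.X * P).degree := by
        refine lt_of_le_of_lt Polynomial.degree_C_le ?_
        rw [Polynomial.degree_eq_natDegree hm.ne_zero, hdeg]
        exact_mod_cast Nat.succ_pos m
      refine ⟨Polynomial.X * P - Polynomial.C (p m : ℤ), hm.sub_of_left hlt, ?_, fun x => ?_⟩
      · rw [Polynomial.natDegree_sub_C, hdeg]
      · simp [G, hP3]
  obtain ⟨P, hP1, -, hP3⟩ := hpoly (dbeta β 1) s
  exact ⟨P, hP1.ne_zero, by rw [hP3, hs]⟩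

lemma noRun_null (k : ℕ) (hk : 3 ≤ k) (N : ℕ) :
    MeasureTheory.volume {β ∈ Trans k | ∀ b, ∃ t, t < N ∧ dbeta β 1 (b + t) ≠ 0} = 0 := by
  have hk' : (3 : ℝ) ≤ k := by exact_mod_cast hk
  refine porous_null _ ((1 / (k:ℝ)) ^ N) (by positivity)
    (pow_le_one₀ (by positivity) (by rw [div_le_one (by linarith)]; linarith)) ?_
  rintro x ⟨⟨h1, h2, h3⟩, h4⟩ ε hε
  obtain ⟨n, hn⟩ := pow_half_lt ε hε
  obtain ⟨l, hl1, hl2, hl3⟩ := cyl_zeros hk h1 h2 h3 n N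
  refine ⟨l, hl1, lt_of_le_of_lt hl2 (hn n le_rfl), fun y hy1 hy2 hy => ?_⟩
  obtain ⟨t, ht, hne⟩ := hy.2 (n + 1)
  exact hne ((hl3 y hy1 hy2).2 t ht)

lemma exists_q {k : ℕ} (hk : 3 ≤ k) {β : ℝ} (h : β ∈ Trans k) :
    ∃ q, 0 < q ∧ dbeta β 1 q ≠ 0 ∧ ∀ s, 0 < s → s < q → dbeta β 1 s = 0 := by
  have hk' : (3 : ℝ) ≤ k := by exact_mod_cast hk
  obtain ⟨h1, h2, h3⟩ := h
  have hex : ∃ q, 0 < q ∧ dbeta β 1 q ≠ 0 := by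
    by_contra hcon
    push Not at hcon
    have hβ : 2 < β := by linarith
    have hG : ∀ j, G (dbeta β 1) (j + 1) β = β ^ j * G (dbeta β 1) 1 β := by
      intro j
      induction j with
      | zero => simp
      | succ j ih =>
        rw [G, ih, hcon (j + 1) (by omega)]
        push_cast; ring
    have hpos : 0 < G (dbeta β 1) 1 β := by
      rw [G_iter (by linarith)]
      exact lt_of_le_of_ne (fbeta_iter_mem 1).1 (h3 1).symm
    obtain ⟨n, hn⟩ := pow_half_lt _ hpos
    have a1 := hn n le_rfl
    have a2 : β ^ n * G (dbeta β 1) 1 β < 1 := by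
      rw [← hG, G_iter (by linarith)]
      exact (fbeta_iter_mem _).2.2 (by omega)
    have a3 : (2:ℝ) ^ n ≤ β ^ n := by gcongr
    have a4 : (2:ℝ) ^ n * (1 / 2) ^ n = 1 := by rw [← mul_pow]; norm_num
    have a5 : (2:ℝ) ^ n * (1 / 2) ^ n < 2 ^ n * G (dbeta β 1) 1 β := by gcongr
    nlinarith
  refine ⟨Nat.find hex, (Nat.find_spec hex).1, (Nat.find_spec hex).2, fun s hs hs1 => ?_⟩
  have := Nat.find_min hex hs1
  push Not at this
  exact this hs

lemma bad_null (k : ℕ) (hk : 3 ≤ k) :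
    MeasureTheory.volume {β ∈ Trans k | ¬ Rec (dbeta β 1)} = 0 := by
  have hk' : (3 : ℝ) ≤ k := by exact_mod_cast hk
  have hsub : {β ∈ Trans k | ¬ Rec (dbeta β 1)} ⊆
      (⋃ N : ℕ, {β ∈ Trans k | ∀ b, ∃ t, t < N ∧ dbeta β 1 (b + t) ≠ 0}) ∪
      {β ∈ Trans k | ¬ Rec (dbeta β 1) ∧ ∀ N, ∃ b, ∀ t, t < N → dbeta β 1 (b + t) = 0} := by
    rintro β ⟨h1, h2⟩
    by_cases h : ∀ N, ∃ b, ∀ t, t < N → dbeta β 1 (b + t) = 0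
    · right; exact ⟨h1, h2, h⟩
    · left
      push Not at h
      obtain ⟨N, hN⟩ := h
      exact Set.mem_iUnion.2 ⟨N, h1, hN⟩
  refine MeasureTheory.measure_mono_null hsub (MeasureTheory.measure_union_null
    (MeasureTheory.measure_iUnion_null (noRun_null k hk)) ?_)
  refine porous_null _ (1 / (k:ℝ)) (by positivity) (by rw [div_le_one (by linarith)]; linarith) ?_
  rintro β ⟨hT, -, hrun⟩ ε hε
  obtain ⟨q, hq0, hq1, hq2⟩ := exists_q hk hT
  obtain ⟨h1, h2, h3⟩ := hT
  obtain ⟨n, hn⟩ := pow_half_lt ε hε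
  -- run length `K = N - 1`
  obtain ⟨K, hKq, hKn, hK1⟩ : ∃ K, q < K ∧ n ≤ K ∧ 1 ≤ K := ⟨q + n + 1, by omega, by omega, by omega⟩
  have hex := hrun K
  obtain ⟨b, hb, hbmin⟩ : ∃ b, (∀ t, t < K → dbeta β 1 (b + t) = 0) ∧
      ∀ b', b' < b → ¬ ∀ t, t < K → dbeta β 1 (b' + t) = 0 :=
    ⟨Nat.find hex, Nat.find_spec hex, fun b' hb' => Nat.find_min hex hb'⟩
  have hb0 : q < b := by
    by_contra hh
    apply hq1
    have := hb (q - b) (by omega)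
    rwa [show b + (q - b) = q by omega] at this
  have hbm : dbeta β 1 (b - 1) ≠ 0 := by
    intro hz
    apply hbmin (b - 1) (by omega)
    intro t ht
    rcases Nat.eq_zero_or_pos t with h | h
    · subst h; simpa using hz
    · have := hb (t - 1) (by omega)
      rwa [show b + (t - 1) = b - 1 + t by omega] at this
  obtain ⟨l, hl1, hl2, hl3⟩ := cyl_zeros hk h1 h2 h3 (b + K - 1) 1
  rw [pow_one, show b + K - 1 + 1 = b + K by omega] at hl3
  refine ⟨l, hl1, lt_of_le_of_lt hl2 (hn _ (by omega)), fun y hy1 hy2 hy => hy.2.1 ?_⟩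
  obtain ⟨hd, hz⟩ := hl3 y hy1 hy2
  refine ⟨b, K + 1, q, hq0, hb0, ?_, ?_, ?_, ?_, ?_⟩
  · rw [hd q (by omega)]; exact hq1
  · intro s hs hs1
    rw [hd s (by omega)]; exact hq2 s hs hs1
  · rw [hd _ (by omega)]; exact hbm
  · intro t ht
    by_cases htK : t < K
    · rw [hd _ (by omega)]; exact hb t htK
    · obtain rfl : t = K := by omega
      have := hz 0 (by omega)
      simpa using this
  · intro b' hb'
    rw [Nat.add_sub_cancel] at hb' ⊢
    have := hbmin b' (by omega)
    push Not at this
    obtain ⟨t, ht, hne⟩ := this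
    exact ⟨t, ht, by rw [hd _ (by omega)]; exact hne⟩


/-! ### Greedy expansions and the lexicographic order -/

lemma fbeta_mem {β : ℝ} {x : ℝ} (hx : x ∈ Set.Icc (0 : ℝ) 1) (s : ℕ) :
    (fbeta β)^[s] x ∈ Set.Icc (0 : ℝ) 1 := by
  cases s with
  | zero => exact hx
  | succ s =>
    rw [Function.iterate_succ_apply']
    exact ⟨Int.fract_nonneg _, (Int.fract_lt_one _).le⟩

lemma dbeta_shift (β x : ℝ) (r s : ℕ) : dbeta β x (r + s) = dbeta β ((fbeta β)^[r] x) s := by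
  unfold dbeta
  rw [add_comm, Function.iterate_add_apply]

/-- Digit sequences of points of `[0,1]` are lexicographically at most that of `1`. -/
lemma dbeta_le {β : ℝ} (hβ : 0 < β) {x y : ℝ} (hx : 0 ≤ x) (hxy : x ≤ y) (L : ℕ) :
    wlt L (dbeta β x) (dbeta β y) ∨ ∀ s, s < L → dbeta β x s = dbeta β y s := by
  by_cases h : ∀ s, s < L → dbeta β x s = dbeta β y s
  · exact Or.inr h
  left
  push Not at h
  obtain ⟨j, hj, hne, hmin⟩ : ∃ j, j < L ∧ dbeta β x j ≠ dbeta β y j ∧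
      ∀ s, s < j → dbeta β x s = dbeta β y s := by
    refine ⟨Nat.find h, (Nat.find_spec h).1, (Nat.find_spec h).2, fun s hs => ?_⟩
    by_contra hc
    exact Nat.find_min h hs ⟨hs.trans (Nat.find_spec h).1, hc⟩
  have hit : ∀ s, s ≤ j → 0 ≤ (fbeta β)^[s] x ∧ (fbeta β)^[s] x ≤ (fbeta β)^[s] y := by
    intro s
    induction s with
    | zero => intro _; exact ⟨hx, hxy⟩
    | succ s ih =>
      intro hs
      obtain ⟨a1, a2⟩ := ih (by omega)
      rw [Function.iterate_succ_apply', Function.iterate_succ_apply']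
      refine ⟨Int.fract_nonneg _, ?_⟩
      have e := hmin s (by omega)
      unfold dbeta at e
      have b1 : 0 ≤ β * (fbeta β)^[s] x := mul_nonneg hβ.le a1
      have b2 : β * (fbeta β)^[s] x ≤ β * (fbeta β)^[s] y := mul_le_mul_of_nonneg_left a2 hβ.le
      have e' : (⌊β * (fbeta β)^[s] x⌋ : ℤ) = ⌊β * (fbeta β)^[s] y⌋ := by
        rw [← Int.natCast_floor_eq_floor b1, ← Int.natCast_floor_eq_floor (b1.trans b2), e]
      unfold fbeta at b2 e' ⊢
      rw [Int.fract, Int.fract, e']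
      linarith
  refine ⟨j, hj, fun s hs => (hmin s hs).le, lt_of_le_of_ne ?_ hne⟩
  unfold dbeta
  exact Nat.floor_le_floor (mul_le_mul_of_nonneg_left (hit j le_rfl).2 hβ.le)

lemma wlt_first {L : ℕ} {u w : ℕ → ℕ} (h : wlt L u w) :
    ∃ j, j < L ∧ (∀ s, s < j → u s = w s) ∧ u j < w j := by
  obtain ⟨j, hj, h1, h2⟩ := h
  have hex : ∃ j, u j < w j := ⟨j, h2⟩
  have hle : Nat.find hex ≤ j := Nat.find_min' hex h2
  refine ⟨Nat.find hex, by omega, fun s hs => ?_, Nat.find_spec hex⟩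
  have a := Nat.find_min hex hs
  have b := h1 s (by omega)
  omega

/-- Truncated evaluation of a digit sequence. -/
noncomputable def ev (β : ℝ) (v : Seq) : ℕ → ℕ → ℝ
  | 0, _ => 0
  | n + 1, r => (v r + ev β v n (r + 1)) / β

lemma ev_nonneg {β : ℝ} (hβ : 0 < β) (v : Seq) (n r : ℕ) : 0 ≤ ev β v n r := by
  induction n generalizing r with
  | zero => exact le_rfl
  | succ n ih =>
    have := ih (r + 1)
    rw [ev]; positivity

/-- Comparison with the orbit of `1` along a common block of digits. -/
lemma ev_le_of_lt {β : ℝ} (hβ : 0 < β) (v : Seq) (j : ℕ) (D : ℝ) :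
    ∀ n r i, i + j < i + n →
      (∀ s, s < j → v (r + s) = dbeta β 1 (i + s)) → v (r + j) < dbeta β 1 (i + j) →
      ev β v (n - j - 1) (r + j + 1) ≤ D →
      ev β v n r ≤ G (dbeta β 1) i β + (D - 1 - G (dbeta β 1) (i + j + 1) β) / β ^ (j + 1) := by
  induction j with
  | zero =>
    intro n r i hn _ hlt hD
    obtain ⟨n, rfl⟩ : ∃ n', n = n' + 1 := ⟨n - 1, by omega⟩
    simp only [add_zero, Nat.sub_zero, Nat.add_sub_cancel] at hD hlt ⊢
    rw [ev, G_succ]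
    have h1 : (v r : ℝ) + 1 ≤ dbeta β 1 i := by exact_mod_cast hlt
    have e : G (dbeta β 1) i β + (D - 1 - (β * G (dbeta β 1) i β - dbeta β 1 i)) / β ^ (0 + 1) =
        (D - 1 + dbeta β 1 i) / β := by
      rw [zero_add, pow_one]; field_simp; ring
    rw [e]
    refine div_le_div_of_nonneg_right ?_ hβ.le
    linarith
  | succ j ih =>
    intro n r i hn heq hlt hD
    obtain ⟨n, rfl⟩ : ∃ n', n = n' + 1 := ⟨n - 1, by omega⟩
    have h1 := ih n (r + 1) (i + 1) (by omega) (fun s hs => by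
      have := heq (s + 1) (by omega)
      rw [show r + 1 + s = r + (s + 1) by omega, show i + 1 + s = i + (s + 1) by omega]; exact this)
      (by rw [show r + 1 + j = r + (j + 1) by omega, show i + 1 + j = i + (j + 1) by omega]; exact hlt)
      (by rw [show r + 1 + j + 1 = r + (j + 1) + 1 by omega,
              show n - j - 1 = n + 1 - (j + 1) - 1 by omega]; exact hD)
    have h0 : v r = dbeta β 1 i := by simpa using heq 0 (by omega)
    rw [ev, h0, div_le_iff₀ hβ, add_mul]
    rw [G_succ] at h1
    have e : (D - 1 - G (dbeta β 1) (i + (j + 1) + 1) β) / β ^ (j + 1 + 1) * β =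
      (D - 1 - G (dbeta β 1) (i + 1 + j + 1) β) / β ^ (j + 1) := by
      rw [show i + (j + 1) + 1 = i + 1 + j + 1 by omega, pow_succ β (j + 1)]
      field_simp
    rw [e]
    linarith

lemma ev_le_of_eq {β : ℝ} (hβ : 0 < β) (v : Seq) :
    ∀ n r i, (∀ s, s < n → v (r + s) = dbeta β 1 (i + s)) → ev β v n r ≤ G (dbeta β 1) i β := by
  intro n
  induction n with
  | zero =>
    intro r i _
    rw [G_iter hβ]; exact (fbeta_iter_mem i).1
  | succ n ih =>
    intro r i heq
    have h1 := ih (r + 1) (i + 1) (fun s hs => by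
      have := heq (s + 1) (by omega)
      rw [show r + 1 + s = r + (s + 1) by omega, show i + 1 + s = i + (s + 1) by omega]; exact this)
    have h0 : v r = dbeta β 1 i := by simpa using heq 0 (by omega)
    rw [ev, h0, div_le_iff₀ hβ]
    rw [G_succ] at h1
    linarith

lemma ev_le_one {β : ℝ} (hβ : 0 < β) {L : ℕ} {v : Seq} (hv : v ∈ XL L (dbeta β 1)) :
    ∀ n r, ev β v n r ≤ 1 := by
  intro n
  induction n using Nat.strong_induction_on with
  | _ n ih =>
    intro r
    obtain ⟨j, hj, h1, h2⟩ := wlt_first (hv r)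
    by_cases hn : j < n
    · have := ev_le_of_lt hβ v j 1 n r 0 (by omega) (by simpa using h1) (by simpa using h2)
        (ih _ (by omega) _)
      have hg : 0 ≤ G (dbeta β 1) (0 + j + 1) β := by
        rw [G_iter hβ]; exact (fbeta_iter_mem _).1
      have h3 : (1 - 1 - G (dbeta β 1) (0 + j + 1) β) / β ^ (j + 1) ≤ 0 :=
        div_nonpos_of_nonpos_of_nonneg (by linarith) (by positivity)
      have h4 : G (dbeta β 1) 0 β = 1 := rfl
      linarith
    · exact ev_le_of_eq hβ v n r 0 (fun s hs => by simpa using h1 s (by omega))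

lemma ev_mono {β : ℝ} (hβ : 0 < β) (v : Seq) (n : ℕ) : ∀ r, ev β v n r ≤ ev β v (n + 1) r := by
  induction n with
  | zero => intro r; exact ev_nonneg hβ v 1 r
  | succ n ih =>
    intro r
    rw [ev, ev]
    have := ih (r + 1)
    gcongr

/-- Parry: sequences in `XL` are greedy expansions. -/
lemma parry {k : ℕ} (hk : 3 ≤ k) {β : ℝ} (hT : β ∈ Trans k) {L : ℕ} {v : Seq}
    (hv : v ∈ XL L (dbeta β 1)) : ∃ x ∈ Set.Icc (0 : ℝ) 1, dbeta β x = v := by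
  have hk' : (3 : ℝ) ≤ k := by exact_mod_cast hk
  obtain ⟨h1, h2, h3⟩ := hT
  have hβ : 0 < β := by linarith
  have hlim : ∀ r, ∃ x, Tendsto (fun n => ev β v n r) atTop (𝓝 x) := fun r =>
    ⟨_, tendsto_atTop_ciSup (monotone_nat_of_le_succ fun n => ev_mono hβ v n r)
      ⟨1, by rintro _ ⟨n, rfl⟩; exact ev_le_one hβ hv n r⟩⟩
  choose X hX using hlim
  have hX0 : ∀ r, 0 ≤ X r := fun r => ge_of_tendsto' (hX r) fun n => ev_nonneg hβ v n r
  have hX1 : ∀ r, X r < 1 := by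
    intro r
    obtain ⟨j, hj, e1, e2⟩ := wlt_first (hv r)
    have hg : 0 < G (dbeta β 1) (j + 1) β := by
      rw [G_iter hβ]; exact lt_of_le_of_ne (fbeta_iter_mem _).1 (h3 _).symm
    have hle : X r ≤ 1 + (1 - 1 - G (dbeta β 1) (j + 1) β) / β ^ (j + 1) := by
      refine le_of_tendsto (hX r) ?_
      filter_upwards [eventually_gt_atTop j] with n hn
      have := ev_le_of_lt hβ v j 1 n r 0 (by omega) (by simpa using e1) (by simpa using e2)
        (ev_le_one hβ hv _ _)
      rw [zero_add] at this
      exact this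
    have : (1 - 1 - G (dbeta β 1) (j + 1) β) / β ^ (j + 1) < 0 :=
      div_neg_of_neg_of_pos (by linarith) (by positivity)
    linarith
  have hrec : ∀ r, β * X r = X (r + 1) + v r := by
    intro r
    have a := (hX r).comp (tendsto_add_atTop_nat 1)
    have b : Tendsto (fun n => ((v r : ℝ) + ev β v n (r + 1)) / β) atTop
        (𝓝 (((v r : ℝ) + X (r + 1)) / β)) := (tendsto_const_nhds.add (hX (r + 1))).div_const β
    have := tendsto_nhds_unique a b
    rw [this]; field_simp; ring
  have hit : ∀ r, (fbeta β)^[r] (X 0) = X r := by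
    intro r
    induction r with
    | zero => rfl
    | succ r ih =>
      rw [Function.iterate_succ_apply', ih, fbeta, hrec, Int.fract_add_natCast,
        Int.fract_eq_self.2 ⟨hX0 _, hX1 _⟩]
  refine ⟨X 0, ⟨hX0 0, (hX1 0).le⟩, ?_⟩
  funext r
  rw [dbeta, hit, hrec, Nat.floor_add_natCast (hX0 _), Nat.floor_eq_zero.2 (hX1 _), zero_add]


/-! ### Moving a zero -/

section Move

variable (L m q : ℕ) (w v : Seq)

/-- Occurrence of the word `w[0..L)` at position `i`. -/
def occ (i : ℕ) : Prop := ∀ s, s < L → v (i + s) = w s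

/-- Positions where a zero is inserted. -/
def stp (n : ℕ) : Prop := ∃ i, occ L w v i ∧ n = i + q

/-- Positions that are delayed by one. -/
def intr (n : ℕ) : Prop := ∃ i, occ L w v i ∧ i + q < n ∧ n < i + L

/-- The rearranged sequence. -/
noncomputable def mv (n : ℕ) : ℕ :=
  if stp L q w v n then 0 else if intr L q w v n then v (n - 1) else v n

end Move

section MoveLemmas

variable {L m N q : ℕ} {w v : Seq}

lemma occ_disj (hL : L = m + N) (hw0 : w 0 ≠ 0) (hwm : w (m - 1) ≠ 0)
    (hz : ∀ t, t < N → w (m + t) = 0)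
    (hno : ∀ b, b + (N - 1) ≤ m → ∃ t, t < N - 1 ∧ w (b + t) ≠ 0)
    {i i' : ℕ} (h1 : occ L w v i) (h2 : occ L w v i') (hlt : i < i') : i + L ≤ i' := by
  by_contra hcon
  obtain ⟨d, rfl⟩ : ∃ d, i' = i + d := ⟨i' - i, by omega⟩
  have hd : d < L := by omega
  by_cases hdm : m ≤ d
  · have a := h1 d hd
    have b := h2 0 (by omega)
    have c := hz (d - m) (by omega)
    rw [show m + (d - m) = d by omega] at c
    rw [add_zero] at b
    omega
  · have hzz : ∀ t, t < N → w (m - d + t) = 0 := by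
      intro t ht
      have a := h1 (m + t) (by omega)
      have b := h2 (m - d + t) (by omega)
      rw [show i + d + (m - d + t) = i + (m + t) by omega] at b
      rw [← b, a, hz t ht]
    by_cases hdN : d - 1 < N
    · have := hzz (d - 1) hdN
      rw [show m - d + (d - 1) = m - 1 by omega] at this
      exact hwm this
    · obtain ⟨t, ht, hne⟩ := hno (m - d) (by omega)
      exact hne (hzz t (by omega))

lemma mv_mem (hL : L = m + N) (hw0 : w 0 ≠ 0) (hwm : w (m - 1) ≠ 0) (hq0 : 0 < q) (hqm : q < m)
    (hwq : w q ≠ 0)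
    (hz : ∀ t, t < N → w (m + t) = 0)
    (hno : ∀ b, b + (N - 1) ≤ m → ∃ t, t < N - 1 ∧ w (b + t) ≠ 0)
    (hv : ∀ r, wlt L (fun s => v (r + s)) w ∨ occ L w v r) : mv L q w v ∈ XL L w := by
  intro r
  have hdisj := fun {i i'} => occ_disj (v := v) (i := i) (i' := i') hL hw0 hwm hz hno
  by_cases hB : intr L q w v r
  · obtain ⟨i, hi, hir, hrL⟩ := hB
    -- the sequence is delayed at `r`
    have hmv : ∀ s, r + s < i + L → mv L q w v (r + s) = w (r - i - 1 + s) := by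
      intro s hs
      unfold mv
      rw [if_neg, if_pos ⟨i, hi, by omega, hs⟩]
      · have := hi (r - i - 1 + s) (by omega)
        rw [← this]; congr 1; omega
      · rintro ⟨i', hi', e⟩
        rcases lt_trichotomy i i' with h | h | h
        · have := hdisj hi hi' h; omega
        · omega
        · have := hdisj hi' hi h; omega
    by_cases hem : m ≤ r - i - 1
    · refine ⟨0, by omega, fun s hs => by omega, ?_⟩
      have a := hmv 0 (by omega)
      have b := hz (r - i - 1 - m) (by omega)
      rw [show m + (r - i - 1 - m) = r - i - 1 + 0 by omega] at b
      show mv L q w v (r + 0) < w 0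
      rw [a, b]; omega
    · obtain ⟨e, he⟩ : ∃ e, e = r - i - 1 := ⟨_, rfl⟩
      have hcontra : (∀ s, e + s < L - 1 → w (e + s) = w s) → False := by
        intro hall
        have hzz : ∀ t, t < N - 1 → w (m - e + t) = 0 := by
          intro t ht
          have := hall (m - e + t) (by omega)
          rw [show e + (m - e + t) = m + t by omega, hz t (by omega)] at this
          exact this.symm
        by_cases h1 : e - 1 < N - 1
        · have := hzz (e - 1) h1
          rw [show m - e + (e - 1) = m - 1 by omega] at this
          exact hwm this
        · obtain ⟨t, ht, hne⟩ := hno (m - e) (by omega)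
          exact hne (hzz t ht)
      rcases hv (i + e) with hlt | ho
      · obtain ⟨j, hj, a1, a2⟩ := wlt_first hlt
        by_cases hje : e + j < L - 1
        · refine ⟨j, hj, fun s hs => ?_, ?_⟩
          · show mv L q w v (r + s) ≤ w s
            rw [hmv s (by omega), ← a1 s hs, ← hi _ (by omega)]
            apply le_of_eq; congr 1; omega
          · show mv L q w v (r + j) < w j
            rw [hmv j (by omega), ← hi _ (by omega)]
            have : i + (r - i - 1 + j) = i + e + j := by omega
            rw [this]; exact a2
        · exfalso
          refine hcontra fun s hs => ?_
          rw [← hi (e + s) (by omega), ← a1 s (by omega)]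
          show v _ = v _
          congr 1; omega
      · exfalso
        refine hcontra fun s hs => ?_
        rw [← hi (e + s) (by omega), ← ho s (by omega)]
        congr 1; omega
  · -- first changed position is a decrease
    have hdec : ∀ n, r ≤ n → (∀ n', r ≤ n' → n' < n → mv L q w v n' = v n') →
        mv L q w v n ≤ v n := by
      intro n hn hprev
      unfold mv
      by_cases hs : stp L q w v n
      · rw [if_pos hs]; exact Nat.zero_le _
      · rw [if_neg hs]
        by_cases hI : intr L q w v n
        · exfalso
          obtain ⟨i, hi, hi1, hi2⟩ := hI
          by_cases hri : r ≤ i + q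
          · have := hprev (i + q) hri hi1
            unfold mv at this
            rw [if_pos ⟨i, hi, rfl⟩, hi q (by omega)] at this
            exact hwq this.symm
          · exact hB ⟨i, hi, by omega, by omega⟩
        · rw [if_neg hI]
    have hfin : ∀ j, j < L → (∀ s, s < j → v (r + s) = w s) → v (r + j) ≤ w j →
        mv L q w v (r + j) < w j → wlt L (fun s => mv L q w v (r + s)) w := by
      intro j hj h1 h2 h3
      by_cases hch : ∃ s, s < j ∧ mv L q w v (r + s) ≠ v (r + s)
      · have hs1 := (Nat.find_spec hch).1
        have hs2 := (Nat.find_spec hch).2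
        have hmin : ∀ s, s < Nat.find hch → mv L q w v (r + s) = v (r + s) := by
          intro s hs
          by_contra hc
          exact Nat.find_min hch hs ⟨by omega, hc⟩
        refine ⟨Nat.find hch, by omega, fun s hs => ?_, ?_⟩
        · show mv L q w v (r + s) ≤ w s
          rw [hmin s hs, h1 s (by omega)]
        · show mv L q w v (r + Nat.find hch) < w (Nat.find hch)
          rw [← h1 _ hs1]
          refine lt_of_le_of_ne (hdec _ (by omega) fun n' hn1 hn2 => ?_) hs2
          have := hmin (n' - r) (by omega)
          rwa [show r + (n' - r) = n' by omega] at this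
      · push Not at hch
        refine ⟨j, hj, fun s hs => ?_, h3⟩
        show mv L q w v (r + s) ≤ w s
        rw [hch s hs, h1 s hs]
    rcases hv r with hlt | ho
    · obtain ⟨j, hj, a1, a2⟩ := wlt_first hlt
      by_cases hch : ∃ s, s < j ∧ mv L q w v (r + s) < w s ∧ ∀ s', s' < s → mv L q w v (r + s') = w s'
      · obtain ⟨s, hs, h1, h2⟩ := hch
        exact ⟨s, by omega, fun s' hs' => (h2 s' hs').le, h1⟩
      · have hall : ∀ s, s < j → mv L q w v (r + s) = w s := by
          intro s
          induction s using Nat.strong_induction_on with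
          | _ s ih =>
            intro hs
            by_contra hne
            apply hch
            refine ⟨s, hs, lt_of_le_of_ne ?_ hne, fun s' hs' => ih s' hs' (by omega)⟩
            rw [← a1 s hs]
            refine hdec _ (by omega) fun n' hn1 hn2 => ?_
            have b1 := ih (n' - r) (by omega) (by omega)
            have b2 := a1 (n' - r) (by omega)
            simp only [show r + (n' - r) = n' by omega] at b1 b2
            rw [b1, b2]
        refine ⟨j, hj, fun s hs => (hall s hs).le, lt_of_le_of_lt ?_ a2⟩
        refine hdec _ (by omega) fun n' hn1 hn2 => ?_
        have b1 := hall (n' - r) (by omega)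
        have b2 := a1 (n' - r) (by omega)
        simp only [show r + (n' - r) = n' by omega] at b1 b2
        rw [b1, b2]
    · refine hfin q (by omega) (fun s hs => ho s (by omega)) (ho q (by omega)).le ?_
      unfold mv
      rw [if_pos ⟨r, ho, rfl⟩]; omega

lemma mv_sum (hL : L = m + N) (hN : 0 < N) (hw0 : w 0 ≠ 0) (hwm : w (m - 1) ≠ 0) (hq0 : 0 < q)
    (hqm : q < m)
    (hz : ∀ t, t < N → w (m + t) = 0)
    (hno : ∀ b, b + (N - 1) ≤ m → ∃ t, t < N - 1 ∧ w (b + t) ≠ 0) (a : ℕ → ℝ) (n : ℕ) :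
    ∑ s ∈ Finset.range (n + 1), a (mv L q w v s) - ∑ s ∈ Finset.range (n + 1), a (v s) =
      if stp L q w v n ∨ intr L q w v n then a 0 - a (v n) else 0 := by
  have hdisj := fun {i i'} => occ_disj (v := v) (i := i) (i' := i') hL hw0 hwm hz hno
  induction n with
  | zero =>
    have h1 : ¬ stp L q w v 0 := by rintro ⟨i, _, e⟩; omega
    have h2 : ¬ intr L q w v 0 := by rintro ⟨i, _, e, _⟩; omega
    simp [mv, h1, h2]
  | succ n ih =>
    rw [Finset.sum_range_succ, Finset.sum_range_succ (fun s => a (v s)), add_sub_add_comm, ih]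
    by_cases h1 : stp L q w v (n + 1)
    · have h2 : ¬ (stp L q w v n ∨ intr L q w v n) := by
        obtain ⟨i, hi, e⟩ := h1
        have aux : ∀ i', occ L w v i' → i' + q ≤ n → n < i' + L → False := by
          intro i' hi' a1 a2
          rcases lt_trichotomy i i' with h | h | h
          · have := hdisj hi hi' h; omega
          · omega
          · have := hdisj hi' hi h; omega
        rintro (⟨i', hi', e'⟩ | ⟨i', hi', a1, a2⟩)
        · exact aux i' hi' (by omega) (by omega)
        · exact aux i' hi' (by omega) (by omega)
      rw [if_neg h2, if_pos (Or.inl h1), mv, if_pos h1]; ring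
    · by_cases h2 : intr L q w v (n + 1)
      · have h3 : stp L q w v n ∨ intr L q w v n := by
          obtain ⟨i, hi, a1, a2⟩ := h2
          rcases eq_or_lt_of_le (show i + q ≤ n by omega) with h | h
          · exact Or.inl ⟨i, hi, h.symm⟩
          · exact Or.inr ⟨i, hi, h, by omega⟩
        rw [if_pos h3, if_pos (Or.inr h2), mv, if_neg h1, if_pos h2, Nat.add_sub_cancel]; ring
      · rw [if_neg (not_or.2 ⟨h1, h2⟩), mv, if_neg h1, if_neg h2]
        by_cases h3 : stp L q w v n ∨ intr L q w v n
        · rw [if_pos h3]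
          have : ∃ i, occ L w v i ∧ i + q ≤ n ∧ n < i + L := by
            rcases h3 with ⟨i, hi, e⟩ | ⟨i, hi, a1, a2⟩
            · exact ⟨i, hi, by omega, by omega⟩
            · exact ⟨i, hi, by omega, by omega⟩
          obtain ⟨i, hi, a1, a2⟩ := this
          have a3 : n + 1 = i + L := by
            by_contra hc
            exact h2 ⟨i, hi, by omega, by omega⟩
          have a4 := hi (L - 1) (by omega)
          have a5 := hz (N - 1) (by omega)
          rw [show m + (N - 1) = L - 1 by omega] at a5
          rw [show i + (L - 1) = n by omega, a5] at a4
          rw [a4]; ring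
        · rw [if_neg h3]; ring

lemma mv_freq {k : ℕ} (hL : L = m + N) (hN : 0 < N) (hw0 : w 0 ≠ 0) (hwm : w (m - 1) ≠ 0)
    (hq0 : 0 < q) (hqm : q < m) (hz : ∀ t, t < N → w (m + t) = 0)
    (hno : ∀ b, b + (N - 1) ≤ m → ∃ t, t < N - 1 ∧ w (b + t) ≠ 0) {α : E k}
    (h : HasDigitFreq k v α) : HasDigitFreq k (mv L q w v) α := by
  intro i hi
  have hb : ∀ n : ℕ, |(digitCount (mv L q w v) i n : ℝ) - digitCount v i n| ≤ 1 := by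
    intro n
    cases n with
    | zero => simp [digitCount]
    | succ n =>
      rw [digitCount_eq_sum, digitCount_eq_sum,
        mv_sum hL hN hw0 hwm hq0 hqm hz hno (fun d => if d = i then (1 : ℝ) else 0)]
      split_ifs <;> simp
  have h0 : Tendsto (fun n : ℕ => ((digitCount (mv L q w v) i n : ℝ) - digitCount v i n) / n) atTop
      (𝓝 0) := by
    refine squeeze_zero_norm (fun n => ?_) (tendsto_const_div_atTop_nhds_zero_nat (1 : ℝ))
    rw [norm_div, Real.norm_eq_abs, Real.norm_eq_abs, Nat.abs_cast]
    exact div_le_div_of_nonneg_right (hb n) (Nat.cast_nonneg n)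
  have := (h i hi).add h0
  rw [add_zero] at this
  refine this.congr fun n => ?_
  ring

end MoveLemmas


/-! ### Realising convex combinations of frequencies -/

/-- Sublinear growth. -/
def LO (f : ℕ → ℝ) : Prop := ∀ δ > 0, ∃ C, 0 ≤ C ∧ ∀ n : ℕ, |f n| ≤ δ * n + C

lemma LO_of_freq {v : Seq} {i : ℕ} {A : ℝ}
    (h : Tendsto (fun r => (digitCount v i r : ℝ) / (r : ℝ)) atTop (𝓝 A)) :
    LO (fun n => digitCount v i n - A * n) := by
  intro δ hδ
  obtain ⟨n0, hn0⟩ := (Metric.tendsto_atTop.1 h) δ hδ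
  refine ⟨n0 * (1 + |A|), by positivity, fun n => ?_⟩
  show |(digitCount v i n : ℝ) - A * n| ≤ δ * n + n0 * (1 + |A|)
  by_cases hn : n0 ≤ n ∧ 0 < n
  · have h1 := hn0 n hn.1
    have hn' : (0 : ℝ) < n := by exact_mod_cast hn.2
    rw [Real.dist_eq] at h1
    have e : (digitCount v i n : ℝ) - A * n = (digitCount v i n / n - A) * n := by
      field_simp
    rw [e, abs_mul, abs_of_pos hn']
    have h2 : (0:ℝ) ≤ n0 * (1 + |A|) := by positivity
    nlinarith
  · have hn1 : n ≤ n0 := by omega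
    have h1 : (digitCount v i n : ℝ) ≤ n := by exact_mod_cast digitCount_le v i n
    have h2 : (n : ℝ) ≤ n0 := by exact_mod_cast hn1
    have h3 : |(digitCount v i n : ℝ) - A * n| ≤ n + |A| * n := by
      refine (abs_sub _ _).trans ?_
      rw [abs_mul, Nat.abs_cast, Nat.abs_cast]
      linarith
    have h4 : 0 ≤ δ * n := by positivity
    nlinarith [abs_nonneg A]

lemma freq_of_LO {v : Seq} {i : ℕ} {A : ℝ} (h : LO (fun n => digitCount v i n - A * n)) :
    Tendsto (fun r => (digitCount v i r : ℝ) / (r : ℝ)) atTop (𝓝 A) := by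
  rw [Metric.tendsto_atTop]
  intro ε hε
  obtain ⟨C, hC, hb⟩ := h (ε / 2) (by linarith)
  obtain ⟨n0, hn0⟩ := exists_nat_gt (C / (ε / 2))
  refine ⟨n0 + 1, fun n hn => ?_⟩
  have hn' : (0 : ℝ) < n := by exact_mod_cast (by omega : 0 < n)
  have hn2 : (n0 : ℝ) < n := by exact_mod_cast (by omega : n0 < n)
  have e : (digitCount v i n : ℝ) / n - A = (digitCount v i n - A * n) / n := by
    field_simp
  rw [Real.dist_eq, e, abs_div, Nat.abs_cast, div_lt_iff₀ hn']
  have := hb n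
  rw [div_lt_iff₀ (by linarith)] at hn0
  nlinarith

lemma seg_count (v : Seq) (i L A : ℕ) :
    |∑ t ∈ Finset.range A, (if (if t + L < A then v t else 0) = i then (1 : ℝ) else 0) -
      digitCount v i A| ≤ L := by
  have hone : ∀ x y : ℕ, |(if x = i then (1 : ℝ) else 0) - (if y = i then (1 : ℝ) else 0)| ≤ 1 := by
    intro x y; split_ifs <;> simp
  rw [digitCount_eq_sum, ← Finset.sum_sub_distrib]
  by_cases h : A ≤ L
  · refine (Finset.abs_sum_le_sum_abs _ _).trans ((Finset.sum_le_sum fun t _ => hone _ _).trans ?_)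
    simpa using h
  · obtain ⟨B, rfl⟩ : ∃ B, A = B + L := ⟨A - L, by omega⟩
    rw [Finset.sum_range_add]
    rw [Finset.sum_eq_zero, zero_add]
    · refine (Finset.abs_sum_le_sum_abs _ _).trans ((Finset.sum_le_sum fun t _ => hone _ _).trans ?_)
      simp
    · intro t ht
      have := Finset.mem_range.1 ht
      rw [if_pos (by omega : t + L < B + L)]
      simp

/-- Interleaving of prefixes of two sequences. -/
def mix (L : ℕ) (v1 v2 : Seq) (A : ℕ → ℕ) (n : ℕ) : ℕ :=
  if n - n.sqrt * n.sqrt < A n.sqrt then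
    (if n - n.sqrt * n.sqrt + L < A n.sqrt then v1 (n - n.sqrt * n.sqrt) else 0)
  else (if n - n.sqrt * n.sqrt - A n.sqrt + L < 2 * n.sqrt + 1 - A n.sqrt then
    v2 (n - n.sqrt * n.sqrt - A n.sqrt) else 0)

lemma mix_eq (L : ℕ) (v1 v2 : Seq) (A : ℕ → ℕ) (j t : ℕ) (ht : t < 2 * j + 1) :
    mix L v1 v2 A (j * j + t) = if t < A j then (if t + L < A j then v1 t else 0)
      else (if t - A j + L < 2 * j + 1 - A j then v2 (t - A j) else 0) := by
  have h : (j * j + t).sqrt = j := Nat.sqrt_add_eq j (by omega)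
  unfold mix
  rw [h, Nat.add_sub_cancel_left]

lemma mix_mem {L : ℕ} {w v1 v2 : Seq} (hw0 : w 0 ≠ 0) (hL : 0 < L) (h1 : v1 ∈ XL L w)
    (h2 : v2 ∈ XL L w) (A : ℕ → ℕ) (hA : ∀ j, A j ≤ 2 * j + 1) : mix L v1 v2 A ∈ XL L w := by
  intro r
  obtain ⟨j, t, ht, rfl⟩ : ∃ j t, t < 2 * j + 1 ∧ r = j * j + t := by
    refine ⟨r.sqrt, r - r.sqrt * r.sqrt, ?_, ?_⟩
    · have := Nat.sqrt_le_add r; omega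
    · have := Nat.sqrt_le r; omega
  have hzero : mix L v1 v2 A (j * j + t) = 0 → wlt L (fun s => mix L v1 v2 A (j * j + t + s)) w := by
    intro h
    refine ⟨0, hL, fun s hs => by omega, ?_⟩
    show mix L v1 v2 A (j * j + t + 0) < w 0
    rw [add_zero, h]; omega
  have htrunc : ∀ u : Seq, u ∈ XL L w → ∀ o, (∀ s, s < L → mix L v1 v2 A (j * j + t + s) ≤ u (o + s)) →
      wlt L (fun s => mix L v1 v2 A (j * j + t + s)) w := by
    intro u hu o hle
    obtain ⟨i, hi, a1, a2⟩ := hu o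
    exact ⟨i, hi, fun s hs => (hle s (by omega)).trans (a1 s hs), lt_of_le_of_lt (hle i hi) a2⟩
  have hAj := hA j
  by_cases htA : t < A j
  · by_cases htL : t + L < A j
    · refine htrunc v1 h1 t fun s hs => ?_
      rw [add_assoc, mix_eq _ _ _ _ _ _ (by omega), if_pos (by omega)]
      split_ifs
      · exact le_rfl
      · exact Nat.zero_le _
    · apply hzero
      rw [mix_eq _ _ _ _ _ _ ht, if_pos htA, if_neg htL]
  · by_cases htL : t - A j + L < 2 * j + 1 - A j
    · refine htrunc v2 h2 (t - A j) fun s hs => ?_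
      rw [add_assoc, mix_eq _ _ _ _ _ _ (by omega), if_neg (by omega)]
      split_ifs
      · rw [show t + s - A j = t - A j + s by omega]
      · exact Nat.zero_le _
    · apply hzero
      rw [mix_eq _ _ _ _ _ _ ht, if_neg htA, if_neg htL]

lemma mix_block (L : ℕ) (v1 v2 : Seq) (A : ℕ → ℕ) (i j : ℕ) (hA : A j ≤ 2 * j + 1) :
    |∑ t ∈ Finset.range (2 * j + 1), (if mix L v1 v2 A (j * j + t) = i then (1 : ℝ) else 0) -
      (digitCount v1 i (A j) + digitCount v2 i (2 * j + 1 - A j))| ≤ 2 * L := by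
  obtain ⟨D, hD⟩ : ∃ D, 2 * j + 1 = A j + D := ⟨2 * j + 1 - A j, by omega⟩
  have e1 : ∑ t ∈ Finset.range (2 * j + 1), (if mix L v1 v2 A (j * j + t) = i then (1 : ℝ) else 0) =
      ∑ t ∈ Finset.range (A j), (if (if t + L < A j then v1 t else 0) = i then (1 : ℝ) else 0) +
      ∑ t ∈ Finset.range D, (if (if t + L < D then v2 t else 0) = i then (1 : ℝ) else 0) := by
    rw [hD, Finset.sum_range_add]
    congr 1
    · refine Finset.sum_congr rfl fun t ht => ?_
      have := Finset.mem_range.1 ht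
      rw [mix_eq _ _ _ _ _ _ (by omega), if_pos this]
    · refine Finset.sum_congr rfl fun t ht => ?_
      have := Finset.mem_range.1 ht
      rw [mix_eq _ _ _ _ _ _ (by omega), if_neg (by omega : ¬ (A j + t < A j)), hD, Nat.add_sub_cancel_left,
        Nat.add_sub_cancel_left]
  rw [e1, hD, Nat.add_sub_cancel_left]
  have a1 := seg_count v1 i L (A j)
  have a2 := seg_count v2 i L D
  rw [abs_le] at *
  constructor <;> linarith [a1.1, a1.2, a2.1, a2.2]

lemma mix_sum (L : ℕ) (v1 v2 : Seq) (A : ℕ → ℕ) (i : ℕ) (a1 a2 c : ℝ)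
    (hc0 : 0 ≤ c) (hc1 : c ≤ 1)
    (hAf : ∀ j, A j = ⌊c * ((2 * j + 1 : ℕ) : ℝ)⌋₊)
    (hA : ∀ j, A j ≤ 2 * j + 1)
    (h1 : LO (fun n => digitCount v1 i n - a1 * n)) (h2 : LO (fun n => digitCount v2 i n - a2 * n)) :
    LO (fun n => digitCount (mix L v1 v2 A) i n - (c * a1 + (1 - c) * a2) * n) := by
  set θ := c * a1 + (1 - c) * a2 with hθ
  set f : ℕ → ℝ := fun s => if mix L v1 v2 A s = i then (1 : ℝ) else 0 with hf
  have hf1 : ∀ s, |f s| ≤ 1 := by intro s; simp only [hf]; split_ifs <;> simp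
  intro δ hδ
  obtain ⟨C1, hC1, hb1⟩ := h1 (δ / 4) (by linarith)
  obtain ⟨C2, hC2, hb2⟩ := h2 (δ / 4) (by linarith)
  obtain ⟨C, hCdef⟩ : ∃ C, C = C1 + C2 + |a1| + |a2| + 2 * L := ⟨_, rfl⟩
  have hC : 0 ≤ C := by rw [hCdef]; positivity
  -- block estimate
  have hblock : ∀ j : ℕ, |∑ t ∈ Finset.range (2 * j + 1), f (j * j + t) - θ * (2 * j + 1 : ℕ)| ≤
      δ / 2 * (2 * j + 1 : ℕ) + C := by
    intro j
    have b0 : |∑ t ∈ Finset.range (2 * j + 1), f (j * j + t) -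
        (digitCount v1 i (A j) + digitCount v2 i (2 * j + 1 - A j))| ≤ 2 * L :=
      mix_block L v1 v2 A i j (hA j)
    have b1 : |(digitCount v1 i (A j) : ℝ) - a1 * (A j : ℝ)| ≤ δ / 4 * (A j : ℝ) + C1 := hb1 (A j)
    have b2 : |(digitCount v2 i (2 * j + 1 - A j) : ℝ) - a2 * ((2 * j + 1 - A j : ℕ) : ℝ)| ≤
        δ / 4 * ((2 * j + 1 - A j : ℕ) : ℝ) + C2 := hb2 _
    have hAT : (A j : ℝ) ≤ (2 * j + 1 : ℕ) := by exact_mod_cast hA j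
    rw [Nat.cast_sub (hA j)] at b2
    obtain ⟨T, hT⟩ : ∃ T : ℝ, T = ((2 * j + 1 : ℕ) : ℝ) := ⟨_, rfl⟩
    have hT0 : 0 ≤ T := by rw [hT]; positivity
    have b3 : |(A j : ℝ) - c * T| ≤ 1 := by
      rw [hAf, ← hT, abs_le]
      have x1 := Nat.floor_le (mul_nonneg hc0 hT0)
      have x2 := Nat.lt_floor_add_one (c * T)
      constructor <;> linarith
    rw [← hT] at b2 hAT ⊢
    have e : ∑ t ∈ Finset.range (2 * j + 1), f (j * j + t) - θ * T =
        (∑ t ∈ Finset.range (2 * j + 1), f (j * j + t) -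
          (digitCount v1 i (A j) + digitCount v2 i (2 * j + 1 - A j))) +
        (digitCount v1 i (A j) - a1 * A j) + (digitCount v2 i (2 * j + 1 - A j) - a2 * (T - A j)) +
        (a1 - a2) * (A j - c * T) := by rw [hθ]; ring
    have b4 : |(a1 - a2) * (A j - c * T)| ≤ |a1| + |a2| := by
      rw [abs_mul]
      have := abs_sub a1 a2
      nlinarith [abs_nonneg (a1 - a2), abs_nonneg ((A j : ℝ) - c * T)]
    rw [e]
    refine (abs_add_le _ _).trans ?_
    refine (add_le_add_left (abs_add_le _ _) _).trans ?_
    refine (add_le_add_left (add_le_add_left (abs_add_le _ _) _) _).trans ?_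
    rw [hCdef]
    have hA0 : (0 : ℝ) ≤ A j := Nat.cast_nonneg _
    nlinarith
  have hsq : ∀ J : ℕ, |∑ s ∈ Finset.range (J * J), f s - θ * (J * J : ℕ)| ≤
      δ / 2 * (J * J : ℕ) + C * J := by
    intro J
    induction J with
    | zero => simp
    | succ J ih =>
      have e0 : (J + 1) * (J + 1) = J * J + (2 * J + 1) := by ring
      rw [e0, Finset.sum_range_add]
      have hb := hblock J
      rw [abs_le] at *
      rw [Nat.cast_add (J * J) (2 * J + 1), Nat.cast_add J 1, Nat.cast_one]
      constructor <;> nlinarith [ih.1, ih.2, hb.1, hb.2]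
  obtain ⟨M, hM⟩ : ∃ M, M = C + 2 + 2 * |θ| := ⟨_, rfl⟩
  have hM0 : 0 ≤ M := by rw [hM]; positivity
  refine ⟨M * M / δ, by positivity, fun n => ?_⟩
  obtain ⟨J, t, ht, rfl⟩ : ∃ j t, t < 2 * j + 1 ∧ n = j * j + t := by
    refine ⟨n.sqrt, n - n.sqrt * n.sqrt, ?_, ?_⟩
    · have := Nat.sqrt_le_add n; omega
    · have := Nat.sqrt_le n; omega
  simp only
  rw [digitCount_eq_sum]
  change |∑ s ∈ Finset.range (J * J + t), f s - θ * (J * J + t : ℕ)| ≤ _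
  rw [Finset.sum_range_add]
  have hs := hsq J
  have ht2 : |∑ s ∈ Finset.range t, f (J * J + s)| ≤ t := by
    refine (Finset.abs_sum_le_sum_abs _ _).trans ((Finset.sum_le_sum fun s _ => hf1 _).trans ?_)
    simp
  have htJ : (t : ℝ) ≤ 2 * J := by exact_mod_cast (by omega : t ≤ 2 * J)
  have e : ∑ s ∈ Finset.range (J * J), f s + ∑ s ∈ Finset.range t, f (J * J + s) -
      θ * (J * J + t : ℕ) = (∑ s ∈ Finset.range (J * J), f s - θ * (J * J : ℕ)) +
      ∑ s ∈ Finset.range t, f (J * J + s) + -(θ * t) := by push_cast; ring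
  rw [e]
  refine (abs_add_le _ _).trans ?_
  refine (add_le_add_left (abs_add_le _ _) _).trans ?_
  rw [abs_neg, abs_mul, Nat.abs_cast]
  have ht0 : (0 : ℝ) ≤ t := Nat.cast_nonneg _
  have hJ0 : (0 : ℝ) ≤ J := Nat.cast_nonneg _
  have hθt : |θ| * t ≤ |θ| * (2 * J) := mul_le_mul_of_nonneg_left htJ (abs_nonneg _)
  have hMJ : M * J ≤ δ / 2 * (J * J) + M * M / δ := by
    rw [← sub_nonneg]
    have : δ / 2 * (J * J) + M * M / δ - M * J = ((δ * J - M) ^ 2 + M ^ 2) / (2 * δ) := by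
      field_simp; ring
    rw [this]; positivity
  push_cast at hs ⊢
  have hδt : 0 ≤ δ * t := by positivity
  have hMe : M * J = C * J + 2 * J + |θ| * (2 * J) := by rw [hM]; ring
  nlinarith

/-- Realised frequencies. -/
def RF (k L : ℕ) (w : Seq) : Set (E k) := {α | ∃ v ∈ XL L w, HasDigitFreq k v α}

lemma RF_convex {k L : ℕ} {w : Seq} (hw0 : w 0 ≠ 0) (hL : 0 < L) : Convex ℝ (RF k L w) := by
  rintro α ⟨v1, hv1, hα⟩ γ ⟨v2, hv2, hγ⟩ a b ha hb hab
  have hA : ∀ j : ℕ, ⌊a * ((2 * j + 1 : ℕ) : ℝ)⌋₊ ≤ 2 * j + 1 := by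
    intro j
    apply Nat.floor_le_of_le
    have : (0:ℝ) ≤ ((2 * j + 1 : ℕ) : ℝ) := Nat.cast_nonneg _
    nlinarith
  refine ⟨mix L v1 v2 (fun j => ⌊a * ((2 * j + 1 : ℕ) : ℝ)⌋₊),
    mix_mem hw0 hL hv1 hv2 _ hA, fun i hi => freq_of_LO ?_⟩
  have e : proj (a • α + b • γ) i = a * proj α i + (1 - a) * proj γ i := by
    have : b = 1 - a := by linarith
    simp [proj, hi, this]
  rw [e]
  exact mix_sum L v1 v2 _ i _ _ a ha (by linarith) (fun j => rfl) hA
    (LO_of_freq (hα i hi)) (LO_of_freq (hγ i hi))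

/-- Periodic sequences have the frequency of their period. -/
lemma per_freq {k p : ℕ} (hp : 0 < p) {c : Seq} (hper : ∀ n, c (n % p) = c n) :
    HasDigitFreq k c (freqVec k c p) := by
  intro i hi
  apply freq_of_LO
  have e : proj (freqVec k c p) i = (digitCount c i p : ℝ) / p := by
    simp [proj, hi, freqVec]
  rw [e]
  have hp' : (0 : ℝ) < p := by exact_mod_cast hp
  have hshift : ∀ n, c (n + p) = c n := by
    intro n
    rw [← hper (n + p), Nat.add_mod_right, hper]
  have hb : ∀ n : ℕ, |(digitCount c i n : ℝ) - digitCount c i p / p * n| ≤ p := by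
    intro n
    induction n using Nat.strong_induction_on with
    | _ n ih =>
      by_cases hn : n < p
      · have x1 : (digitCount c i n : ℝ) ≤ n := by exact_mod_cast digitCount_le c i n
        have x2 : (digitCount c i p : ℝ) / p ≤ 1 := by
          rw [div_le_one hp']; exact_mod_cast digitCount_le c i p
        have x3 : (0:ℝ) ≤ (digitCount c i p : ℝ) / p := by positivity
        have x4 : (0:ℝ) ≤ digitCount c i n := by positivity
        have x5 : (n : ℝ) < p := by exact_mod_cast hn
        have x6 : (0:ℝ) ≤ n := by positivity
        rw [abs_le]
        constructor <;> nlinarith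
      · obtain ⟨n', rfl⟩ : ∃ n', n = p + n' := ⟨n - p, by omega⟩
        have := ih n' (by omega)
        have e2 : (digitCount c i (p + n') : ℝ) = digitCount c i p + digitCount c i n' := by
          rw [digitCount_eq_sum, digitCount_eq_sum, digitCount_eq_sum, Finset.sum_range_add]
          congr 1
          refine Finset.sum_congr rfl fun s _ => ?_
          rw [add_comm, hshift]
        rw [e2]
        have e3 : (digitCount c i p : ℝ) + digitCount c i n' - digitCount c i p / p * (p + n' : ℕ) =
            digitCount c i n' - digitCount c i p / p * n' := by
          push_cast; field_simp; ring
        rw [e3]; exact this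
  intro δ hδ
  refine ⟨p, hp'.le, fun n => (hb n).trans ?_⟩
  have : 0 ≤ δ * n := by positivity
  linarith

lemma hull_sub_RF {k L : ℕ} {w : Seq} (hw0 : w 0 ≠ 0) (hL : 0 < L) :
    convexHull ℝ (Vset k L w) ⊆ RF k L w := by
  refine convexHull_min ?_ (RF_convex hw0 hL)
  rintro α ⟨c, hc, p, hp, _, hper, rfl⟩
  exact ⟨c, hc, per_freq hp hper⟩

lemma simplex_convex (k : ℕ) : Convex ℝ (simplex k) := by
  rintro x ⟨hx1, hx2⟩ y ⟨hy1, hy2⟩ a b ha hb hab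
  refine ⟨fun i => ?_, ?_⟩
  · have := hx1 i; have := hy1 i
    simp only [PiLp.add_apply, PiLp.smul_apply, smul_eq_mul]
    positivity
  · simp only [PiLp.add_apply, PiLp.smul_apply, smul_eq_mul]
    rw [Finset.sum_add_distrib, ← Finset.mul_sum, ← Finset.mul_sum, hx2, hy2]
    linarith


lemma DF_polytope {k : ℕ} (hk : 3 ≤ k) {β : ℝ} (hT : β ∈ Trans k) (hR : Rec (dbeta β 1)) :
    ∃ V : Finset (E k), (∀ v ∈ V, v ∈ simplex k ∧ ∀ i : Fin k, ∃ q : ℚ, v i = (q : ℝ)) ∧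
        DFbeta k β = convexHull ℝ (V : Set (E k)) := by
  have hk' : (3 : ℝ) ≤ k := by exact_mod_cast hk
  have hβ : 0 < β := by have := hT.1; linarith
  obtain ⟨m, N, q, hq0, hqm, hwq, -, hwm, hz, hno⟩ := hR
  have hw0 := dbeta_zero hk hT.1 hT.2.1
  have hw0' : dbeta β 1 0 ≠ 0 := by omega
  have hwk : dbeta β 1 0 < k := by omega
  have hN : 0 < N := by
    by_contra h
    obtain rfl : N = 0 := by omega
    obtain ⟨t, ht, _⟩ := hno 0 (by omega)
    omega
  have hfin := Vset_finite k (m + N) (dbeta β 1)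
  refine ⟨hfin.toFinset, fun v hv => Vset_rat hwk (hfin.mem_toFinset.1 hv), ?_⟩
  rw [hfin.coe_toFinset]
  apply Set.Subset.antisymm
  · rintro α ⟨-, x, hx, hα⟩
    have hle : ∀ r, wlt (m + N) (fun s => dbeta β x (r + s)) (dbeta β 1) ∨
        occ (m + N) (dbeta β 1) (dbeta β x) r := by
      intro r
      have hm := fbeta_mem (β := β) hx r
      have hfun : (fun s => dbeta β x (r + s)) = dbeta β ((fbeta β)^[r] x) :=
        funext fun s => dbeta_shift β x r s
      rcases dbeta_le hβ hm.1 hm.2 (m + N) with h | h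
      · left; rw [hfun]; exact h
      · right
        intro s hs
        rw [dbeta_shift]; exact h s hs
    exact freq_mem_hull hwk
      (mv_mem rfl hw0' hwm hq0 hqm hwq hz hno hle)
      (mv_freq rfl hN hw0' hwm hq0 hqm hz hno hα)
  · intro α hα
    have hs : α ∈ simplex k :=
      convexHull_min (fun v hv => (Vset_rat hwk hv).1) (simplex_convex k) hα
    obtain ⟨v, hv, hf⟩ := hull_sub_RF hw0' (by omega) hα
    obtain ⟨x, hx, hxv⟩ := parry hk hT hv
    exact ⟨hs, x, hx, by rw [hxv]; exact hf⟩

/-- for Lebesgue-a.e. `β ∈ (k−1,k)`, `DF(β)` is a polytope with rational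
vertices. -/
theorem stmt16 (k : ℕ) (hk : 3 ≤ k) :
    MeasureTheory.volume {β ∈ Set.Ioo ((k : ℝ) - 1) (k : ℝ) |
      ¬ ∃ V : Finset (E k), (∀ v ∈ V, v ∈ simplex k ∧ ∀ i : Fin k, ∃ q : ℚ, v i = (q : ℝ)) ∧
        DFbeta k β = convexHull ℝ (V : Set (E k))} = 0 := by
  refine MeasureTheory.measure_mono_null ?_
    (MeasureTheory.measure_union_null (not_trans_null k hk) (bad_null k hk))
  rintro β ⟨hβ, hn⟩
  by_cases hT : β ∈ Trans k
  · right
    exact ⟨hT, fun hR => hn (DF_polytope hk hT hR)⟩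
  · left
    exact ⟨hβ, hT⟩

end BetaDF
end
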